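/- arXiv:1003.5983 — 7 statements merged into one kernel-verified Lean document; each statement's English description precedes it below -/
import Mathlib

section
/- For every compact set C ⊆ 2^ℕ and every finite set τ ⊆ ℕ, the set F_τ(C) is open in [ω]^ω. -/
open MeasureTheory TopologicalSpace

/-- The space `[ω]^ω` of infinite subsets of `ℕ`, topologized as a subspace of the
Cantor space `ℕ → Bool` via characteristic functions. -/
abbrev IOI := {x : ℕ → Bool // {n | x n = true}.Infinite}

/-- A set is `Σ¹₂` if it is the image of a coanalytic subset of Baire space under a
continuous map. -/
def Sigma12 {X : Type*} [TopologicalSpace X] (A : Set X) : Prop :=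
  ∃ (C : Set (ℕ → ℕ)) (f : (ℕ → ℕ) → X),
    MeasureTheory.AnalyticSet Cᶜ ∧ Continuous f ∧ f '' C = A

/-- A topological space is zero-dimensional if it has a basis of clopen sets. -/
def ZeroDim (X : Type*) [TopologicalSpace X] : Prop :=
  ∃ b : Set (Set X), (∀ s ∈ b, IsClopen s) ∧ TopologicalSpace.IsTopologicalBasis b

/-- `A` is `Σ¹₂`-complete: `A` is `Σ¹₂` and every `Σ¹₂` subset of a zero-dimensional
Polish space is a continuous preimage of `A`. -/
def Sigma12Complete {X : Type*} [TopologicalSpace X] (A : Set X) : Prop :=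
  Sigma12 A ∧
  ∀ (Z : Type) [TopologicalSpace Z] [PolishSpace Z], ZeroDim Z →
    ∀ B : Set Z, Sigma12 B → ∃ f : Z → X, Continuous f ∧ f ⁻¹' A = B

/-- `F_τ(C) = {a ∈ [ω]^ω : a ∩ {0,…,max τ} ≠ τ, or there is no x ∈ C with x(n) = 1
for every n ∈ a with n > max τ}` (stated max-free). -/
def FSet (τ : Finset ℕ) (C : Set (ℕ → Bool)) : Set IOI :=
  {a | ¬((∀ m ∈ τ, a.1 m = true) ∧ ∀ n, a.1 n = true → (∃ m ∈ τ, n ≤ m) → n ∈ τ)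
       ∨ ¬ ∃ x ∈ C, ∀ n, a.1 n = true → (∀ m ∈ τ, m < n) → x n = true}

/-- An implication between the truth of two continuous Boolean functions is a closed condition. -/
theorem isClosed_setOf_eq_true_imp {X : Type*} [TopologicalSpace X] {f g : X → Bool}
    (hf : Continuous f) (hg : Continuous g) : IsClosed {x | f x = true → g x = true} :=
  (isClosed_discrete {p : Bool × Bool | p.1 = true → p.2 = true}).preimage (hf.prodMk hg)

/-- Agreeing with `τ` on the initial segment up to its maximum is a closed condition. -/
theorem isClosed_setOf_initialSegment (τ : Finset ℕ) :
    IsClosed {a : IOI | (∀ m ∈ τ, a.1 m = true) ∧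
      ∀ n, a.1 n = true → (∃ m ∈ τ, n ≤ m) → n ∈ τ} := by
  have hc : ∀ n, Continuous fun a : IOI => a.1 n := fun n =>
    (continuous_apply n).comp continuous_subtype_val
  simp only [Set.ofPred_and, Set.ofPred_forall]
  exact (isClosed_iInter fun m => isClosed_iInter fun _ =>
    (isClosed_discrete {true}).preimage (hc m)).inter
    (isClosed_iInter fun n =>
      (isClosed_discrete {b : Bool | b = true → (∃ m ∈ τ, n ≤ m) → n ∈ τ}).preimage (hc n))

/-- The sets whose tail (along `P`) is contained in some member of a compact set form a
closed set. -/
theorem isClosed_setOf_exists_forall_imp {C : Set (ℕ → Bool)} (hC : IsCompact C)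
    (P : ℕ → Prop) :
    IsClosed {a : IOI | ∃ x ∈ C, ∀ n, a.1 n = true → P n → x n = true} := by
  have : CompactSpace C := isCompact_iff_compactSpace.mp hC
  have hcl : IsClosed {p : IOI × C | ∀ n, P n → p.1.1 n = true → p.2.1 n = true} := by
    simp only [Set.ofPred_forall]
    exact isClosed_iInter fun n => isClosed_iInter fun _ =>
      isClosed_setOf_eq_true_imp
        ((continuous_apply n).comp (continuous_subtype_val.comp continuous_fst))
        ((continuous_apply n).comp (continuous_subtype_val.comp continuous_snd))
  convert isClosedMap_fst_of_compactSpace _ hcl using 1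
  ext a
  constructor
  · rintro ⟨x, hx, h⟩
    exact ⟨(a, ⟨x, hx⟩), fun n hP ha => h n ha hP, rfl⟩
  · rintro ⟨⟨b, x⟩, h, rfl⟩
    exact ⟨x.1, x.2, fun n ha hP => h n hP ha⟩

/-- For compact `C ⊆ 2^ℕ` and finite `τ ⊆ ℕ`, the set `F_τ(C)` is open in `[ω]^ω`. -/
theorem statement5 (C : Set (ℕ → Bool)) (hC : IsCompact C) (τ : Finset ℕ) :
    IsOpen (FSet τ C) := by
  exact (isClosed_setOf_initialSegment τ).isOpen_compl.union
    (isClosed_setOf_exists_forall_imp hC fun n => ∀ m ∈ τ, m < n).isOpen_compl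
end

section
/- For every finite set τ ⊆ ℕ and every finite strictly increasing sequence σ of naturals, the set {C ∈ K(2^ℕ) : ([ω]^ω \ F_τ(C)) ∩ [σ] ≠ ∅} is an analytic subset of K(2^ℕ), where [σ] = {a ∈ [ω]^ω : the increasing enumeration of a extends σ}; consequently, the map C ↦ [ω]^ω \ F_τ(C) from K(2^ℕ) to the space of closed subsets of [ω]^ω is Σ¹₁∪Π¹₁-submeasurable with respect to the subbase {D : D ∩ [σ] ≠ ∅}, {D : D ∩ [σ] = ∅}. -/
open MeasureTheory TopologicalSpace

/-- A pruned tree of strictly increasing finite sequences of naturals: nonempty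
(contains the empty sequence), all members strictly increasing, closed under
initial segments, and every member has a proper extension in the tree. -/
def PrunedIncTree (T : List ℕ → Bool) : Prop :=
  T [] = true ∧
  (∀ l, T l = true → List.Chain' (· < ·) l) ∧
  (∀ l n, T (l ++ [n]) = true → T l = true) ∧
  (∀ l, T l = true → ∃ n, T (l ++ [n]) = true)

/-- The initial segment of length `k` of the increasing enumeration of `a ∈ [ω]^ω`. -/
noncomputable def enumList (a : IOI) (k : ℕ) : List ℕ :=
  (List.range k).map (Nat.nth fun n => a.1 n = true)

/-- The closed set `C_T ⊆ [ω]^ω` coded by `T`: all `a` all of whose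
increasing-enumeration initial segments lie in `T`. -/
def treeClosedSet (T : List ℕ → Bool) : Set IOI :=
  {a | ∀ k, T (enumList a k) = true}

/-- The hyperspace `K(X)` of compact subsets of `X`. -/
def KSp (X : Type*) [TopologicalSpace X] := {C : Set X // IsCompact C}

/-- The Vietoris topology on `K(X)`, generated by the sets `{C : C ⊆ U}` and
`{C : C ∩ U ≠ ∅}` for `U` open. -/
instance (X : Type*) [TopologicalSpace X] : TopologicalSpace (KSp X) :=
  TopologicalSpace.generateFrom
    ({S | ∃ U : Set X, IsOpen U ∧ S = {C : KSp X | C.1 ⊆ U}} ∪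
     {S | ∃ U : Set X, IsOpen U ∧ S = {C : KSp X | (C.1 ∩ U).Nonempty}})

/-- `[σ] ⊆ [ω]^ω`: the sets whose increasing enumeration extends `σ`. -/
def cylEnum (σ : List ℕ) : Set IOI := {a | enumList a σ.length = σ}

/-- The natural map from Mathlib's hyperspace of compact sets to `KSp`. -/
def compactsToKSp {X : Type*} [TopologicalSpace X] (K : Compacts X) : KSp X :=
  ⟨K, K.isCompact⟩

theorem continuous_compactsToKSp {X : Type*} [TopologicalSpace X] :
    Continuous (compactsToKSp (X := X)) := by
  refine continuous_generateFrom_iff.2 ?_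
  rintro _ (⟨U, hU, rfl⟩ | ⟨U, hU, rfl⟩)
  · exact Compacts.isOpen_subsets_of_isOpen hU
  · exact Compacts.isOpen_inter_nonempty_of_isOpen hU

/-- Membership of a point in a compact set is a closed relation in a Hausdorff space. -/
theorem isClosed_setOf_mem_compacts {X : Type*} [TopologicalSpace X] [T2Space X] :
    IsClosed {p : Compacts X × X | p.2 ∈ p.1} := by
  rw [← isOpen_compl_iff, isOpen_iff_mem_nhds]
  rintro ⟨K, x⟩ hx
  obtain ⟨U, V, hU, hV, hKU, hxV, hUV⟩ :=
    K.isCompact.separation_of_notMem hx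
  filter_upwards [prod_mem_nhds ((Compacts.isOpen_subsets_of_isOpen hU).mem_nhds hKU)
    (hV.mem_nhds hxV)]
  rintro ⟨L, y⟩ ⟨hL, hy⟩ hyL
  exact Set.disjoint_left.1 hUV (hL hyL) hy

/-- A second countable compact Hausdorff space is Polish. -/
theorem polishSpace_of_compactSpace (X : Type*) [TopologicalSpace X] [CompactSpace X]
    [T2Space X] [SecondCountableTopology X] : PolishSpace X := by
  have : MetrizableSpace X := metrizableSpace_of_t3_secondCountable X
  let := metrizableSpaceMetric X
  infer_instance

/-- The increasing enumeration of an infinite set extends `σ` iff each `σ[i]` is the element of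
the set with exactly `i` predecessors. -/
theorem mem_cylEnum_iff (a : IOI) (σ : List ℕ) :
    a ∈ cylEnum σ ↔ ∀ i (h : i < σ.length),
      a.1 σ[i] = true ∧ Nat.count (fun n => a.1 n = true) σ[i] = i := by
  have hinf : (Set.ofPred fun n => a.1 n = true).Infinite := a.2
  have key : a ∈ cylEnum σ ↔
      ∀ i (h : i < σ.length), Nat.nth (fun n => a.1 n = true) i = σ[i] := by
    simp only [cylEnum, enumList, Set.mem_ofPred_eq]
    constructor
    · intro h i hi
      have := List.getElem_of_eq h (i := i) (by simpa using hi)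
      simpa using this
    · intro h
      refine List.ext_getElem (by simp) fun i _ h₂ => ?_
      simpa using h i h₂
  rw [key]
  refine forall₂_congr fun i hi => ⟨fun h => ?_, fun ⟨h₁, h₂⟩ => ?_⟩
  · rw [← h]
    exact ⟨Nat.nth_mem_of_infinite hinf i, Nat.count_nth_of_infinite hinf i⟩
  · have := Nat.nth_count (p := fun n => a.1 n = true) h₁
    rwa [h₂] at this

theorem measurable_count_eq_true (m : ℕ) :
    Measurable fun a : ℕ → Bool => Nat.count (fun n => a n = true) m := by
  induction m with
  | zero => simp
  | succ m ih =>
    simp only [Nat.count_succ]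
    exact ih.add (Measurable.ite (measurableSet_eq_fun (measurable_pi_apply m) measurable_const)
      measurable_const measurable_const)

/-- The Borel relation on triples `(K, a, x)` expressing that `a` is infinite, lies in `[σ]`,
meets `{0, …, max τ}` in `τ`, and is contained in `x` above `max τ`, where `x ∈ K`. -/
def witnessSet (τ : Finset ℕ) (σ : List ℕ) :
    Set (Compacts (ℕ → Bool) × (ℕ → Bool) × (ℕ → Bool)) :=
  {p | p.2.2 ∈ p.1 ∧ (∀ N, ∃ n, N < n ∧ p.2.1 n = true) ∧
    (∀ m ∈ τ, p.2.1 m = true) ∧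
    (∀ n, p.2.1 n = true → (∃ m ∈ τ, n ≤ m) → n ∈ τ) ∧
    (∀ n, p.2.1 n = true → (∀ m ∈ τ, m < n) → p.2.2 n = true) ∧
    ∀ i (h : i < σ.length),
      p.2.1 σ[i] = true ∧ Nat.count (fun n => p.2.1 n = true) σ[i] = i}

theorem analyticSet_witnessSet (τ : Finset ℕ) (σ : List ℕ) :
    AnalyticSet (witnessSet τ σ) := by
  have := polishSpace_of_compactSpace (Compacts (ℕ → Bool) × (ℕ → Bool) × (ℕ → Bool))
  let : MeasurableSpace (Compacts (ℕ → Bool)) := borel _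
  have : BorelSpace (Compacts (ℕ → Bool)) := ⟨rfl⟩
  have ha : ∀ n, Measurable
      fun p : Compacts (ℕ → Bool) × (ℕ → Bool) × (ℕ → Bool) => p.2.1 n = true := fun n =>
    measurableSet_setOfPred.1 (measurableSet_eq_fun
      ((measurable_pi_apply n).comp (measurable_fst.comp measurable_snd)) measurable_const)
  have hx : ∀ n, Measurable
      fun p : Compacts (ℕ → Bool) × (ℕ → Bool) × (ℕ → Bool) => p.2.2 n = true := fun n =>
    measurableSet_setOfPred.1 (measurableSet_eq_fun
      ((measurable_pi_apply n).comp (measurable_snd.comp measurable_snd)) measurable_const)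
  refine MeasurableSet.analyticSet ?_
  refine measurableSet_setOfPred.2 (.and ?_ (.and ?_ (.and ?_ (.and ?_ (.and ?_ ?_)))))
  · exact measurableSet_setOfPred.1 (isClosed_setOf_mem_compacts.preimage
      (f := fun p : Compacts (ℕ → Bool) × (ℕ → Bool) × (ℕ → Bool) => (p.1, p.2.2))
      (by fun_prop)).measurableSet
  · exact .forall fun N => .exists fun n => measurable_const.and (ha n)
  · exact .forall fun m => measurable_const.imp (ha m)
  · exact .forall fun n => (ha n).imp measurable_const
  · exact .forall fun n => (ha n).imp (measurable_const.imp (hx n))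
  · exact .forall fun i => .forall fun hi => (ha _).and (measurableSet_setOfPred.1
      (measurableSet_eq_fun
        ((measurable_count_eq_true _).comp (measurable_fst.comp measurable_snd))
        measurable_const))

theorem image_witnessSet (τ : Finset ℕ) (σ : List ℕ) :
    (fun p : Compacts (ℕ → Bool) × (ℕ → Bool) × (ℕ → Bool) => compactsToKSp p.1) '' witnessSet τ σ =
      {C : KSp (ℕ → Bool) | (((FSet τ C.1)ᶜ) ∩ cylEnum σ).Nonempty} := by
  ext C
  constructor
  · rintro ⟨⟨K, a, x⟩, ⟨hxK, hinf, hτ, hτ', hax, hσ⟩, rfl⟩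
    have ha : {n | a n = true}.Infinite := by
      refine Set.infinite_of_not_bddAbove fun ⟨N, hN⟩ => ?_
      obtain ⟨n, hn, han⟩ := hinf N
      exact (hN han).not_gt hn
    refine ⟨⟨a, ha⟩, ?_, (mem_cylEnum_iff _ _).2 hσ⟩
    rintro (h | h)
    · exact h ⟨hτ, hτ'⟩
    · exact h ⟨x, hxK, hax⟩
  · rintro ⟨a, haF, haσ⟩
    obtain ⟨h₁, h₂⟩ := not_or.1 haF
    obtain ⟨hτ, hτ'⟩ := not_not.1 h₁
    obtain ⟨x, hxC, hax⟩ := not_not.1 h₂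
    refine ⟨(⟨C.1, C.2⟩, a.1, x), ⟨hxC, fun N => ?_, hτ, hτ', hax,
      (mem_cylEnum_iff _ _).1 haσ⟩, rfl⟩
    obtain ⟨n, hn, hNn⟩ := a.2.exists_gt N
    exact ⟨n, hNn, hn⟩

/-- For every finite `τ ⊆ ℕ` and strictly increasing finite sequence `σ`, the set
`{C ∈ K(2^ℕ) : ([ω]^ω \ F_τ(C)) ∩ [σ] ≠ ∅}` is analytic; consequently the map
`C ↦ [ω]^ω \ F_τ(C)` is `Σ¹₁∪Π¹₁`-submeasurable w.r.t. the subbase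
`{D : D ∩ [σ] ≠ ∅}`, `{D : D ∩ [σ] = ∅}` of the space of closed subsets of `[ω]^ω`. -/
theorem statement6 (τ : Finset ℕ) (σ : List ℕ) (hσ : List.Chain' (· < ·) σ) :
    AnalyticSet {C : KSp (ℕ → Bool) | (((FSet τ C.1)ᶜ) ∩ cylEnum σ).Nonempty} ∧
    (AnalyticSet {C : KSp (ℕ → Bool) | (((FSet τ C.1)ᶜ) ∩ cylEnum σ).Nonempty} ∨
      AnalyticSet {C : KSp (ℕ → Bool) | (((FSet τ C.1)ᶜ) ∩ cylEnum σ).Nonempty}ᶜ) ∧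
    (AnalyticSet {C : KSp (ℕ → Bool) | ((FSet τ C.1)ᶜ) ∩ cylEnum σ = ∅} ∨
      AnalyticSet {C : KSp (ℕ → Bool) | ((FSet τ C.1)ᶜ) ∩ cylEnum σ = ∅}ᶜ) := by
  have h : AnalyticSet {C : KSp (ℕ → Bool) | (((FSet τ C.1)ᶜ) ∩ cylEnum σ).Nonempty} := by
    rw [← image_witnessSet]
    exact (analyticSet_witnessSet τ σ).image_of_continuous
      (continuous_compactsToKSp.comp continuous_fst)
  refine ⟨h, Or.inl h, Or.inr ?_⟩
  convert h using 1
  ext C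
  exact Set.nonempty_iff_ne_empty.symm
end

section
/- For every compact set C ⊆ 2^ℕ, the following are equivalent: (1) there is no infinite set a ⊆ ℕ such that for every x ∈ C the values x(n) for n ∈ a converge to 0 (i.e., for every x ∈ C at most finitely many n ∈ a have x(n) = 1); (2) the G_δ set ⋂_{τ finite ⊆ ℕ} F_τ(C) is Ramsey null. -/
open MeasureTheory TopologicalSpace

/-- The Ellentuck basic set `[σ,s]`: all infinite `a ⊆ ℕ` with `a ∩ {0,…,max σ} = σ`
and every element of `a` greater than `max σ` lying in `s` (stated max-free:
`σ ⊆ a`, and every element of `a` outside `σ` lies in `s` and is above all of `σ`). -/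
def ES (σ : Finset ℕ) (s : Set ℕ) : Set IOI :=
  {a | (∀ m ∈ σ, a.1 m = true) ∧
       ∀ n, a.1 n = true → n ∉ σ → n ∈ s ∧ ∀ m ∈ σ, m < n}

/-- A legitimate Ellentuck pair: `s` is infinite and `max σ < min s`. -/
def GoodPair (σ : Finset ℕ) (s : Set ℕ) : Prop :=
  s.Infinite ∧ ∀ m ∈ σ, ∀ n ∈ s, m < n

/-- `A ⊆ [ω]^ω` is Ramsey null if every Ellentuck basic set `[σ,s]` can be shrunk to
`[σ,s']` (with `s' ⊆ s` infinite, `min s' > max σ`) disjoint from `A`. -/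
def RamseyNull (A : Set IOI) : Prop :=
  ∀ σ : Finset ℕ, ∀ s : Set ℕ, GoodPair σ s →
    ∃ s' ⊆ s, s'.Infinite ∧ (∀ m ∈ σ, ∀ n ∈ s', m < n) ∧ ES σ s' ∩ A = ∅

/-- `A` is Ramsey positive if it is not Ramsey null. -/
def RamseyPositive (A : Set IOI) : Prop := ¬ RamseyNull A

/-- For compact `C ⊆ 2^ℕ`: there is no infinite `a ⊆ ℕ` along which every `x ∈ C`
converges to `0` iff the `G_δ` set `⋂_τ F_τ(C)` is Ramsey null. -/
theorem statement7 (C : Set (ℕ → Bool)) (hC : IsCompact C) :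
    (¬ ∃ a : Set ℕ, a.Infinite ∧ ∀ x ∈ C, {n ∈ a | x n = true}.Finite) ↔
      RamseyNull (⋂ τ : Finset ℕ, FSet τ C) := by
  classical
  constructor
  · intro h σ s hs
    push Not at h
    obtain ⟨x, hxC, hx⟩ := h s hs.1
    refine ⟨{n ∈ s | x n = true}, fun n hn => hn.1, hx, fun m hm n hn => hs.2 m hm n hn.1, ?_⟩
    rw [Set.eq_empty_iff_forall_notMem]
    rintro b ⟨hb, hbF⟩
    rcases Set.mem_iInter.1 hbF σ with h₁ | h₁
    · refine h₁ ⟨hb.1, fun n hn ⟨m, hm, hnm⟩ => ?_⟩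
      by_contra hnσ
      exact absurd ((hb.2 n hn hnσ).2 m hm) (by omega)
    · exact h₁ ⟨x, hxC, fun n hn hlt => (hb.2 n hn fun hnσ => (hlt n hnσ).false).1.2⟩
  · rintro h ⟨a, ha, hconv⟩
    obtain ⟨s', hs'a, hs', -, hdisj⟩ := h ∅ a ⟨ha, by simp⟩
    let b : IOI := ⟨fun n => decide (n ∈ s'), by simpa using hs'⟩
    refine (Set.eq_empty_iff_forall_notMem.1 hdisj) b ⟨⟨by simp, fun n hn _ => ?_⟩, ?_⟩
    · exact ⟨of_decide_eq_true hn, by simp⟩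
    · refine Set.mem_iInter.2 fun τ => Or.inr ?_
      rintro ⟨x, hxC, hx⟩
      refine hs' (((hconv x hxC).union (Set.finite_Iic (τ.sup id))).subset fun n hn => ?_)
      by_cases hτ : ∀ m ∈ τ, m < n
      · exact Or.inl ⟨hs'a hn, hx n (decide_eq_true hn) hτ⟩
      · push Not at hτ
        obtain ⟨m, hm, hnm⟩ := hτ
        exact Or.inr (hnm.trans (Finset.le_sup (f := id) hm))
end

section
/- Let X be a zero-dimensional Polish space with a fixed countable subbase consisting of clopen sets and let A ⊆ X. If A is (Σ¹₂,Σ¹₁∪Π¹₁)-complete, then A is Σ¹₂-complete. -/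
open MeasureTheory TopologicalSpace

/-- `f` is `Σ¹₁∪Π¹₁`-submeasurable with respect to the subbase `U` of the target:
the preimage of every subbasic set is analytic or coanalytic. -/
def Submeasurable {Z X : Type*} [TopologicalSpace Z] {ι : Type*} (U : ι → Set X)
    (f : Z → X) : Prop :=
  ∀ i, AnalyticSet (f ⁻¹' U i) ∨ AnalyticSet (f ⁻¹' U i)ᶜ

/-- `A` is `(Σ¹₂,Σ¹₁∪Π¹₁)`-complete with respect to the subbase `U`: `A` is `Σ¹₂` and
every `Σ¹₂` subset of a zero-dimensional Polish space is a preimage of `A` under a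
`Σ¹₁∪Π¹₁`-submeasurable map. -/
def SubComplete {X : Type*} [TopologicalSpace X] {ι : Type*} (U : ι → Set X)
    (A : Set X) : Prop :=
  Sigma12 A ∧
  ∀ (Z : Type) [TopologicalSpace Z] [PolishSpace Z], ZeroDim Z →
    ∀ B : Set Z, Sigma12 B → ∃ f : Z → X, Submeasurable U f ∧ f ⁻¹' A = B

/-- The list of the first `n` values of `v`. -/
def initSeg (v : ℕ → ℕ) (n : ℕ) : List ℕ := (List.range n).map v

lemma initSeg_succ (v : ℕ → ℕ) (n : ℕ) : initSeg v (n + 1) = initSeg v n ++ [v n] := by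
  simp [initSeg, List.range_succ]

lemma initSeg_congr {v w : ℕ → ℕ} {n : ℕ} (h : ∀ m < n, v m = w m) :
    initSeg v n = initSeg w n :=
  List.map_congr_left fun m hm ↦ h m (List.mem_range.1 hm)

lemma eq_of_initSeg_eq {v w : ℕ → ℕ} {n : ℕ} (h : initSeg v n = initSeg w n) {m : ℕ}
    (hm : m < n) : v m = w m :=
  List.map_inj_left.1 h m (List.mem_range.2 hm)

/-- The answers given by the strategy `σ` along the sequence of moves `v`. -/
def answers (σ : List ℕ → ℕ) (v : ℕ → ℕ) : ℕ → ℕ := fun n ↦ σ (initSeg v n)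

/-- `v` is the lexicographically least element of `P`. -/
def IsLexMin (P : Set (ℕ → ℕ)) (v : ℕ → ℕ) : Prop :=
  v ∈ P ∧ ∀ w ∈ P, ∀ n, (∀ m < n, w m = v m) → v n ≤ w n

lemma IsLexMin.unique {P : Set (ℕ → ℕ)} {v w : ℕ → ℕ} (hv : IsLexMin P v)
    (hw : IsLexMin P w) : v = w := by
  funext n
  induction n using Nat.strong_induction_on with
  | _ n ih =>
    exact le_antisymm (hv.2 w hw.1 n fun m hm ↦ (ih m hm).symm) (hw.2 v hv.1 n ih)

/-- The value `κ L σ` depends only on the values of `σ` at lists with smaller code than `L`. -/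
def Causal (κ : List ℕ → (List ℕ → ℕ) → ℕ) : Prop :=
  ∀ L σ τ, (∀ M, Encodable.encode M < Encodable.encode L → σ M = τ M) → κ L σ = κ L τ

/-- On the extensions of `e`, the strategy `σ` is computed by `κ`. -/
def Follows (κ : List ℕ → (List ℕ → ℕ) → ℕ) (e : List ℕ) (σ : List ℕ → ℕ) : Prop :=
  ∀ L, e <+: L → σ L = κ L σ

/-- No causal rule prescribing strategies in `C` above `e` prevents the sections of `Q` from
containing a sequence that starts with `e`. -/
def Unkillable (Q : Set ((List ℕ → ℕ) × (ℕ → ℕ))) (C : Set (List ℕ → ℕ)) (e : List ℕ) : Prop :=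
  ∀ κ, Causal κ → ∃ σ ∈ C, Follows κ e σ ∧ ∃ v, initSeg v e.length = e ∧ (σ, v) ∈ Q

lemma Causal.continuous {κ : List ℕ → (List ℕ → ℕ) → ℕ} (hκ : Causal κ) (L : List ℕ) :
    Continuous (κ L) := by
  have hfin : {M : List ℕ | Encodable.encode M < Encodable.encode L}.Finite :=
    (Set.finite_lt_nat _).preimage Encodable.encode_injective.injOn
  refine IsLocallyConstant.continuous ((IsLocallyConstant.iff_exists_open _).2 fun σ ↦
    ⟨⋂ M ∈ {M : List ℕ | Encodable.encode M < Encodable.encode L}, {τ | τ M = σ M},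
      hfin.isOpen_biInter fun M _ ↦ ?_, ?_, fun τ hτ ↦ ?_⟩)
  · exact (isOpen_discrete ({σ M} : Set ℕ)).preimage
      (continuous_apply (A := fun _ : List ℕ ↦ ℕ) M)
  · simp
  · exact hκ L τ σ fun M hM ↦ Set.mem_iInter₂.1 hτ M hM

lemma Causal.isClosed_follows {κ : List ℕ → (List ℕ → ℕ) → ℕ} (hκ : Causal κ) (e : List ℕ) :
    IsClosed {σ | Follows κ e σ} := by
  simp only [Follows, Set.ofPred_forall]
  exact isClosed_iInter fun L ↦ isClosed_iInter fun _ ↦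
    isClosed_eq (continuous_apply L) (hκ.continuous L)

lemma continuous_of_initial_dependence {α : Type*} [TopologicalSpace α]
    {F : (ℕ → ℕ) → α} (N : ℕ) (h : ∀ z w : ℕ → ℕ, (∀ i < N, z i = w i) → F z = F w) :
    Continuous F :=
  IsLocallyConstant.continuous ((IsLocallyConstant.iff_exists_open _).2 fun z ↦
    ⟨PiNat.cylinder z N, PiNat.isOpen_cylinder _ z N, PiNat.self_mem_cylinder z N,
      fun w hw ↦ h w z fun i hi ↦ hw i hi⟩)

/-- Move one step down a position, answering `a` there and killing all smaller children. -/
lemma Unkillable.exists_child {Q : Set ((List ℕ → ℕ) × (ℕ → ℕ))} {C : Set (List ℕ → ℕ)}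
    {e : List ℕ} (hC : IsClosed C) (h : Unkillable Q C e) (a : ℕ) :
    ∃ C' ⊆ C, ∃ c, IsClosed C' ∧ Unkillable Q C' (e ++ [c]) ∧ (∀ σ ∈ C', σ e = a) ∧
      ∀ c' < c, ∀ σ ∈ C', ∀ v, initSeg v (e.length + 1) = e ++ [c'] → (σ, v) ∉ Q := by
  classical
  have key : ∀ (D : Set (List ℕ → ℕ)) (c : ℕ), ∃ κ, Causal κ ∧
      (¬ Unkillable Q D (e ++ [c]) → ∀ σ ∈ D, Follows κ (e ++ [c]) σ →
        ∀ v, initSeg v (e.length + 1) = e ++ [c] → (σ, v) ∉ Q) := by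
    intro D c
    by_cases hD : Unkillable Q D (e ++ [c])
    · exact ⟨fun _ _ ↦ 0, fun _ _ _ _ ↦ rfl, fun h ↦ absurd hD h⟩
    · have := hD
      simp only [Unkillable, not_forall] at this
      obtain ⟨κ, hκ, hk⟩ := this
      refine ⟨κ, hκ, fun _ σ hσ hf v hv hQ ↦ hk ⟨σ, hσ, hf, v, ?_, hQ⟩⟩
      simpa using hv
  choose κ hκ hkill using key
  let D : ℕ → Set (List ℕ → ℕ) := fun c ↦
    Nat.rec (C ∩ {σ | σ e = a}) (fun c D ↦ D ∩ {σ | Follows (κ D c) (e ++ [c]) σ}) c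
  have hD0 : D 0 = C ∩ {σ | σ e = a} := rfl
  have hDs : ∀ c, D (c + 1) = D c ∩ {σ | Follows (κ (D c) c) (e ++ [c]) σ} := fun _ ↦ rfl
  have hanti : Antitone D := antitone_nat_of_succ_le fun c ↦ by
    rw [hDs]; exact Set.inter_subset_left
  have hclosed : ∀ c, IsClosed (D c) := by
    intro c
    induction c with
    | zero => exact hC.inter (isClosed_eq (continuous_apply e) continuous_const)
    | succ c ih => rw [hDs]; exact ih.inter ((hκ _ _).isClosed_follows _)
  have hsub : ∀ c, D c ⊆ C ∩ {σ | σ e = a} := fun c ↦ hanti (Nat.zero_le c)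
  by_cases hex : ∃ c, Unkillable Q (D c) (e ++ [c])
  · refine ⟨D (Nat.find hex), fun σ hσ ↦ (hsub _ hσ).1, Nat.find hex, hclosed _,
      Nat.find_spec hex, fun σ hσ ↦ (hsub _ hσ).2, fun c' hc' σ hσ ↦ ?_⟩
    have hσ' := hanti (Nat.succ_le_of_lt hc') hσ
    rw [Nat.succ_eq_add_one, hDs] at hσ'
    exact hkill _ _ (Nat.find_min hex hc') σ hσ'.1 hσ'.2
  · push Not at hex
    exfalso
    obtain ⟨σ, hσC, hσ, v, hv, hQ⟩ := h
      (fun L σ ↦ if L = e then a else κ (D (L.getD e.length 0)) (L.getD e.length 0) L σ) (by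
        intro L σ τ hL
        beta_reduce
        split_ifs
        · rfl
        · exact hκ _ _ L σ τ hL)
    have hmem : ∀ c, σ ∈ D c := by
      intro c
      induction c with
      | zero => exact ⟨hσC, by simpa using hσ e List.prefix_rfl⟩
      | succ c ih =>
        refine ⟨ih, fun L hL ↦ ?_⟩
        have h1 := hσ L ((List.prefix_append e [c]).trans hL)
        obtain ⟨t, rfl⟩ := hL
        simpa using h1
    refine hkill _ _ (hex (v e.length)) σ (hmem _) ?_ v ?_ hQ
    · have := hmem (v e.length + 1)
      rw [hDs] at this
      exact this.2
    · rw [initSeg_succ, hv]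

/-- The value at a list whose code is smaller than the length of the position can be fixed. -/
lemma Unkillable.exists_value {Q : Set ((List ℕ → ℕ) × (ℕ → ℕ))} {C : Set (List ℕ → ℕ)}
    {e : List ℕ} (h : Unkillable Q C e) {M : List ℕ} (hM : Encodable.encode M < e.length) :
    ∃ b, Unkillable Q (C ∩ {σ | σ M = b}) e := by
  by_contra! hb
  simp only [Unkillable, not_forall] at hb
  choose κ hκ hk using hb
  have hlt : ∀ L, e <+: L → Encodable.encode M < Encodable.encode L := fun L hL ↦
    hM.trans_le (hL.length_le.trans (Encodable.length_le_encode L))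
  classical
  obtain ⟨σ, hσC, hσ, v, hv, hQ⟩ := h (fun L σ ↦ if e <+: L then κ (σ M) L σ else 0) (by
    intro L σ τ hL
    by_cases he : e <+: L
    · simp only [he, if_true]
      rw [hL M (hlt L he)]
      exact hκ _ L σ τ hL
    · simp [he])
  refine hk (σ M) ⟨σ, ⟨hσC, rfl⟩, fun L hL ↦ ?_, v, hv, hQ⟩
  simpa [hL] using hσ L hL

/-- A closed relation between strategies and plays with nonempty sections can be uniformized on
the left: every sequence `z` is, continuously in `z`, the sequence of answers of a strategy `G z`
along the lexicographically least play `V z` related to it. -/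
theorem exists_continuous_isLexMin {Q : Set ((List ℕ → ℕ) × (ℕ → ℕ))} (hQ : IsClosed Q)
    (hne : ∀ σ, ∃ v, (σ, v) ∈ Q) :
    ∃ (G : (ℕ → ℕ) → List ℕ → ℕ) (V : (ℕ → ℕ) → ℕ → ℕ), Continuous G ∧ Continuous V ∧
      ∀ z, IsLexMin {v | (G z, v) ∈ Q} (V z) ∧ answers (G z) (V z) = z := by
  let St : ℕ → Type := fun n ↦ {p : Set (List ℕ → ℕ) × List ℕ //
    IsClosed p.1 ∧ Unkillable Q p.1 p.2 ∧ p.2.length = n}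
  have step : ∀ n (s : St n) (a : ℕ), ∃ (t : St (n + 1)) (c b : ℕ),
      t.1.1 ⊆ s.1.1 ∧ t.1.2 = s.1.2 ++ [c] ∧ (∀ σ ∈ t.1.1, σ s.1.2 = a) ∧
      (∀ σ ∈ t.1.1, σ (Denumerable.ofNat (List ℕ) n) = b) ∧
      ∀ c' < c, ∀ σ ∈ t.1.1, ∀ v, initSeg v (n + 1) = s.1.2 ++ [c'] → (σ, v) ∉ Q := by
    rintro n ⟨⟨C, e⟩, hC, hu, hn⟩ a
    obtain ⟨C', hsub, c, hC', hu', ha, hk⟩ := hu.exists_child hC a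
    obtain ⟨b, hb⟩ := hu'.exists_value (M := Denumerable.ofNat (List ℕ) n) (by
      simp only at hn
      rw [List.length_append, hn]
      simp)
    subst hn
    exact ⟨⟨(C' ∩ {σ | σ (Denumerable.ofNat (List ℕ) e.length) = b}, e ++ [c]),
      hC'.inter (isClosed_eq (continuous_apply _) continuous_const), hb, by simp⟩, c, b,
      fun σ hσ ↦ hsub hσ.1, rfl, fun σ hσ ↦ ha σ hσ.1, fun σ hσ ↦ hσ.2,
      fun c' hc' σ hσ ↦ hk c' hc' σ hσ.1⟩
  choose next c b hsub hnext ha hb hk using step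
  have hstart : Unkillable Q Set.univ [] := by
    intro κ hκ
    have hrec : ∃ σ : List ℕ → ℕ, ∀ L, σ L = κ L σ := by
      let s : ℕ → List ℕ → ℕ := fun n ↦ Nat.rec (fun _ ↦ 0) (fun _ σ L ↦ κ L σ) n
      have hs : ∀ n L, s (n + 1) L = κ L (s n) := fun _ _ ↦ rfl
      have hstab : ∀ n, ∀ L, Encodable.encode L < n → s (n + 1) L = s n L := by
        intro n
        induction n with
        | zero => intro L hL; omega
        | succ n ih =>
          intro L hL
          rw [hs (n + 1), hs n]
          exact hκ _ _ _ fun M hM ↦ ih M (by omega)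
      have hle : ∀ m n, m ≤ n → ∀ L, Encodable.encode L < m → s n L = s m L := by
        intro m n hmn
        induction n, hmn using Nat.le_induction with
        | base => intros; rfl
        | succ n hmn ih => intro L hL; rw [hstab n L (by omega), ih L hL]
      refine ⟨fun L ↦ s (Encodable.encode L + 1) L, fun L ↦ ?_⟩
      change s (Encodable.encode L + 1) L = _
      rw [hs]
      exact hκ _ _ _ fun M hM ↦ hle _ _ hM M (Nat.lt_succ_self _)
    obtain ⟨σ, hσ⟩ := hrec
    obtain ⟨v, hv⟩ := hne σ
    exact ⟨σ, trivial, fun L _ ↦ hσ L, v, rfl, hv⟩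
  let st : (z : ℕ → ℕ) → (n : ℕ) → St n := fun z n ↦
    Nat.rec ⟨(Set.univ, []), isClosed_univ, hstart, rfl⟩ (fun n s ↦ next n s (z n)) n
  have hst : ∀ z n, st z (n + 1) = next n (st z n) (z n) := fun _ _ ↦ rfl
  have hdep : ∀ n (z w : ℕ → ℕ), (∀ i < n, z i = w i) → st z n = st w n := by
    intro n z w
    induction n with
    | zero => intro _; rfl
    | succ n ih =>
      intro h
      rw [hst, hst, ih fun i hi ↦ h i (by omega), h n (Nat.lt_succ_self n)]
  let V : (ℕ → ℕ) → ℕ → ℕ := fun z n ↦ c n (st z n) (z n)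
  let B : (ℕ → ℕ) → ℕ → ℕ := fun z n ↦ b n (st z n) (z n)
  let G : (ℕ → ℕ) → List ℕ → ℕ := fun z L ↦ B z (Encodable.encode L)
  have hpos : ∀ z n, (st z n).1.2 = initSeg (V z) n := by
    intro z n
    induction n with
    | zero => rfl
    | succ n ih => rw [hst, hnext, ih, initSeg_succ]
  have hanti : ∀ z m n, m ≤ n → (st z n).1.1 ⊆ (st z m).1.1 := by
    intro z m n hmn
    induction n, hmn using Nat.le_induction with
    | base => exact subset_rfl
    | succ n _ ih => exact ((hst z n).symm ▸ hsub n (st z n) (z n)).trans ih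
  have hG : ∀ z n, ∀ σ ∈ (st z n).1.1, ∀ L, Encodable.encode L < n → σ L = G z L := by
    intro z n σ hσ L hL
    have h1 := hanti z _ _ hL hσ
    rw [Nat.succ_eq_add_one, hst] at h1
    have h2 := hb _ _ _ σ h1
    rwa [Denumerable.ofNat_encode] at h2
  have happrox : ∀ z n, ∃ σ ∈ (st z n).1.1, ∃ v, initSeg v n = initSeg (V z) n ∧ (σ, v) ∈ Q := by
    intro z n
    obtain ⟨σ, hσ, -, v, hv, hvQ⟩ := (st z n).2.2.1 (fun _ _ ↦ 0) fun _ _ _ _ ↦ rfl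
    rw [(st z n).2.2.2, hpos] at hv
    exact ⟨σ, hσ, v, hv, hvQ⟩
  choose σ hσ v hv hvQ using happrox
  have hσlim : ∀ z, Filter.Tendsto (σ z) Filter.atTop (nhds (G z)) := fun z ↦
    tendsto_pi_nhds.2 fun L ↦ tendsto_atTop_of_eventually_const (i₀ := Encodable.encode L + 1)
      fun n hn ↦ hG z n _ (hσ z n) L hn
  have hvlim : ∀ z, Filter.Tendsto (v z) Filter.atTop (nhds (V z)) := fun z ↦
    tendsto_pi_nhds.2 fun i ↦ tendsto_atTop_of_eventually_const (i₀ := i + 1)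
      fun n hn ↦ eq_of_initSeg_eq (hv z n) hn
  have hmem : ∀ z n, G z ∈ (st z n).1.1 := fun z n ↦
    (st z n).2.1.mem_of_tendsto (hσlim z)
      ((Filter.eventually_ge_atTop n).mono fun m hm ↦ hanti z n m hm (hσ z m))
  refine ⟨G, V, continuous_pi fun L ↦ ?_, continuous_pi fun n ↦ ?_, fun z ↦ ⟨⟨?_, ?_⟩, ?_⟩⟩
  · refine continuous_of_initial_dependence (Encodable.encode L + 1) fun z w h ↦ ?_
    simp only [G, B]
    rw [hdep _ z w fun i hi ↦ h i (by omega), h _ (Nat.lt_succ_self _)]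
  · refine continuous_of_initial_dependence (n + 1) fun z w h ↦ ?_
    simp only [V]
    rw [hdep _ z w fun i hi ↦ h i (by omega), h _ (Nat.lt_succ_self _)]
  · exact hQ.mem_of_tendsto ((hσlim z).prodMk_nhds (hvlim z)) (Filter.Eventually.of_forall (hvQ z))
  · intro w hw n hwn
    by_contra! hlt
    refine hk n (st z n) (z n) (w n) hlt (G z) (hst z n ▸ hmem z (n + 1)) w ?_ hw
    rw [initSeg_succ, hpos, initSeg_congr hwn]
  · funext n
    have := ha n (st z n) (z n) (G z) (hst z n ▸ hmem z (n + 1))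
    rwa [hpos] at this

lemma zeroDim_pi_nat (K : Type*) : ZeroDim (K → ℕ) := by
  refine ⟨_, ?_, isTopologicalBasis_pi fun _ : K ↦ isTopologicalBasis_singletons ℕ⟩
  rintro _ ⟨u, F, -, rfl⟩
  exact ⟨isClosed_set_pi fun _ _ ↦ isClosed_discrete _,
    isOpen_set_pi F.finite_toSet fun _ _ ↦ isOpen_discrete _⟩

/-- A zero-dimensional second-countable Hausdorff space maps continuously and injectively into
the Baire space. -/
lemma ZeroDim.exists_continuous_injective {Z : Type*} [TopologicalSpace Z]
    [SecondCountableTopology Z] [T2Space Z] (h : ZeroDim Z) :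
    ∃ φ : Z → ℕ → ℕ, Continuous φ ∧ Function.Injective φ := by
  classical
  obtain ⟨b, hb, hbasis⟩ := h
  obtain ⟨t, htb, htc, ht⟩ := hbasis.exists_countable
  obtain ⟨u, hu⟩ := (htc.insert Set.univ).exists_eq_range (Set.insert_nonempty _ _)
  have hclopen : ∀ n, IsClopen (u n) := fun n ↦ by
    rcases (hu ▸ Set.mem_range_self n : u n ∈ insert Set.univ t) with h | h
    · exact h ▸ isClopen_univ
    · exact hb _ (htb h)
  refine ⟨fun z n ↦ if z ∈ u n then 1 else 0, continuous_pi fun n ↦ ?_, fun x y hxy ↦ ?_⟩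
  · exact continuous_const.if (fun z hz ↦ by simp [(hclopen n).frontier_eq] at hz) continuous_const
  · by_contra hne
    obtain ⟨s, hs, hxs, hsy⟩ := ht.exists_subset_of_mem_open
      (show x ∈ ({y}ᶜ : Set Z) from hne) isOpen_compl_singleton
    obtain ⟨n, rfl⟩ : s ∈ Set.range u := hu ▸ Set.mem_insert_of_mem _ hs
    have := congrFun hxy n
    have hy : y ∉ u n := fun hy ↦ hsy hy rfl
    simp [hxs, hy] at this

lemma continuous_answers :
    Continuous fun p : (List ℕ → ℕ) × (ℕ → ℕ) ↦ answers p.1 p.2 := by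
  refine continuous_pi fun n ↦ continuous_iff_continuousAt.2 fun p ↦ ?_
  have hev : ∀ᶠ q : (List ℕ → ℕ) × (ℕ → ℕ) in nhds p,
      q.1 (initSeg p.2 n) = answers q.1 q.2 n := by
    filter_upwards [((PiNat.isOpen_cylinder _ p.2 n).preimage continuous_snd).mem_nhds
      (PiNat.self_mem_cylinder p.2 n)] with q hq
    rw [answers, initSeg_congr fun m hm ↦ (hq m hm).symm]
  exact (((continuous_apply _).comp continuous_fst).continuousAt).congr hev

/-- A continuous image of a coanalytic subset of a Polish space is `Σ¹₂`. -/
lemma Sigma12.image {X Y : Type*} [TopologicalSpace X] [TopologicalSpace Y] [PolishSpace Y]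
    [Nonempty Y] {D : Set Y} (hD : AnalyticSet Dᶜ) {g : Y → X} (hg : Continuous g) :
    Sigma12 (g '' D) := by
  obtain ⟨p, hp, hsurj⟩ := PolishSpace.exists_nat_nat_continuous_surjective Y
  exact ⟨p ⁻¹' D, g ∘ p, hD.preimage hp, hg.comp hp, by
    rw [Set.image_comp, Set.image_preimage_eq _ hsurj]⟩

/-- Closed sets can be coded by sequences of natural numbers. -/
lemma exists_codes_of_closed (W : Type*) [TopologicalSpace W] [SecondCountableTopology W] :
    ∃ O : ℕ → Set W, (∀ k, IsOpen (O k)) ∧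
      ∀ Q, IsClosed Q → ∃ w : ℕ → ℕ, ∀ x, x ∈ Q ↔ ∀ k, w k = 0 → x ∉ O k := by
  classical
  obtain ⟨O, hO⟩ := ((countable_countableBasis W).insert Set.univ).exists_eq_range
    (Set.insert_nonempty _ _)
  refine ⟨O, fun k ↦ ?_, fun Q hQ ↦ ⟨fun k ↦ if Disjoint (O k) Q then 0 else 1, fun x ↦ ?_⟩⟩
  · rcases (hO ▸ Set.mem_range_self k : O k ∈ insert Set.univ (countableBasis W)) with h | h
    · exact h ▸ isOpen_univ
    · exact isOpen_of_mem_countableBasis h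
  · refine ⟨fun hx k hk hxk ↦ ?_, fun hx ↦ ?_⟩
    · have hdisj : Disjoint (O k) Q := by simpa using hk
      exact Set.disjoint_left.1 hdisj hxk hx
    · by_contra hxQ
      obtain ⟨s, hs, hxs, hsQ⟩ := (isBasis_countableBasis W).exists_subset_of_mem_open
        (show x ∈ Qᶜ from hxQ) hQ.isOpen_compl
      obtain ⟨k, rfl⟩ : s ∈ Set.range O := hO ▸ Set.mem_insert_of_mem _ hs
      exact hx k (if_pos (Set.disjoint_left.2 fun y hy ↦ hsQ hy)) hxs

/-- An analytic set is the projection of a closed subset of its product with the Baire space. -/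
lemma MeasureTheory.AnalyticSet.exists_isClosed {W : Type*} [TopologicalSpace W] [T2Space W]
    {S : Set W} (hS : AnalyticSet S) :
    ∃ E : Set (W × (ℕ → ℕ)), IsClosed E ∧ ∀ x, x ∈ S ↔ ∃ y, (x, y) ∈ E := by
  rw [AnalyticSet] at hS
  rcases hS with rfl | ⟨h, hh, rfl⟩
  · exact ⟨∅, isClosed_empty, by simp⟩
  · exact ⟨{p | h p.2 = p.1}, isClosed_eq (hh.comp continuous_snd) continuous_fst, by simp⟩

/-- There is a closed relation whose lexicographically least sections decide membership in
countably many given analytic sets. -/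
lemma exists_isClosed_isLexMin_decides {W ι : Type*} [TopologicalSpace W] [T2Space W]
    [Countable ι] {S : ι → Set W} (hS : ∀ i, AnalyticSet (S i)) :
    ∃ (Q : Set (W × (ℕ → ℕ))) (j : ι → ℕ), IsClosed Q ∧ (∀ x, ∃ v, (x, v) ∈ Q) ∧
      ∀ x v, IsLexMin {v | (x, v) ∈ Q} v → ∀ i, v (j i) = 0 ↔ x ∈ S i := by
  classical
  choose E hE hSE using fun i ↦ (hS i).exists_isClosed
  obtain ⟨enc, henc⟩ := exists_injective_nat ι
  let Q : Set (W × (ℕ → ℕ)) := {p | ∀ i, p.2 (Nat.pair (enc i) 0) = 0 →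
    (p.1, fun m ↦ p.2 (Nat.pair (enc i) (m + 1))) ∈ E i}
  refine ⟨Q, fun i ↦ Nat.pair (enc i) 0, ?_, fun x ↦ ⟨fun _ ↦ 1, by simp [Q]⟩,
    fun x v hv i ↦ ⟨fun h ↦ (hSE i x).2 ⟨_, hv.1 i h⟩, fun hx ↦ ?_⟩⟩
  · have hQ : Q = ⋂ i, ({p | p.2 (Nat.pair (enc i) 0) = 0}ᶜ ∪
        (fun p : W × (ℕ → ℕ) ↦ (p.1, fun m ↦ p.2 (Nat.pair (enc i) (m + 1)))) ⁻¹' E i) := by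
      ext p
      simp [Q, imp_iff_not_or]
    rw [hQ]
    refine isClosed_iInter fun i ↦ IsClosed.union ?_ ((hE i).preimage (by fun_prop))
    exact ((isOpen_discrete ({0} : Set ℕ)).preimage
      ((continuous_apply (A := fun _ : ℕ ↦ ℕ) _).comp continuous_snd)).isClosed_compl
  · by_contra hne
    obtain ⟨y, hy⟩ := (hSE i x).1 hx
    let w : ℕ → ℕ := fun m ↦ if (Nat.unpair m).1 = enc i then
      Nat.casesOn (Nat.unpair m).2 0 y else v m
    have hw : w ∈ {v | (x, v) ∈ Q} := by
      intro i' hi'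
      by_cases hii : i' = i
      · subst hii
        simpa [w] using hy
      · have henc' : enc i' ≠ enc i := fun h ↦ hii (henc h)
        simp only [w, Nat.unpair_pair, henc', if_false] at hi' ⊢
        exact hv.1 i' hi'
    have := hv.2 w hw (Nat.pair (enc i) 0) fun m hm ↦ if_neg fun hmi ↦ by
      rw [← Nat.pair_unpair m, hmi] at hm
      rcases Nat.eq_zero_or_pos (Nat.unpair m).2 with h0 | h0
      · rw [h0] at hm; exact lt_irrefl _ hm
      · exact lt_asymm hm (Nat.pair_lt_pair_right _ h0)
    simp [w] at this
    exact hne this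

lemma MeasureTheory.AnalyticSet.union {W : Type*} [TopologicalSpace W] {S T : Set W}
    (hS : AnalyticSet S) (hT : AnalyticSet T) : AnalyticSet (S ∪ T) := by
  rw [Set.union_eq_iUnion]
  exact AnalyticSet.iUnion (Bool.forall_bool.2 ⟨hT, hS⟩)

/-- Being the lexicographically least element of a section of a closed relation is coanalytic. -/
lemma analyticSet_compl_isLexMin {W : Type*} [TopologicalSpace W] [PolishSpace W]
    {R : Set (W × (ℕ → ℕ))} (hR : IsClosed R) :
    AnalyticSet {p : W × (ℕ → ℕ) | IsLexMin {v | (p.1, v) ∈ R} p.2}ᶜ := by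
  have heq : {p : W × (ℕ → ℕ) | IsLexMin {v | (p.1, v) ∈ R} p.2}ᶜ = Rᶜ ∪ ⋃ n : ℕ,
      Prod.fst '' {q : (W × (ℕ → ℕ)) × (ℕ → ℕ) | (q.1.1, q.2) ∈ R ∧
        (∀ m < n, q.2 m = q.1.2 m) ∧ q.2 n < q.1.2 n} := by
    ext ⟨x, v⟩
    have : (∃ n, ∃ w, (x, w) ∈ R ∧ (∀ m < n, w m = v m) ∧ w n < v n) ↔
        ¬ ∀ w, (x, w) ∈ R → ∀ n, (∀ m < n, w m = v m) → v n ≤ w n := by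
      push Not
      exact ⟨fun ⟨n, w, h⟩ ↦ ⟨w, h.1, n, h.2⟩, fun ⟨w, h, n, h'⟩ ↦ ⟨n, w, h, h'⟩⟩
    simp only [IsLexMin, Set.mem_compl_iff, Set.mem_ofPred_eq, Set.mem_union, Set.mem_iUnion,
      Set.mem_image, Prod.exists, exists_and_right, exists_eq_right, not_and_or]
    simpa using or_congr_right this.symm
  rw [heq]
  borelize (W × (ℕ → ℕ))
  refine hR.measurableSet.compl.analyticSet.union (AnalyticSet.iUnion fun n ↦
    (IsClosed.analyticSet ?_).image_of_continuous continuous_fst)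
  have hcoord : ∀ m, Continuous fun q : (W × (ℕ → ℕ)) × (ℕ → ℕ) ↦ (q.2 m, q.1.2 m) := by
    fun_prop
  refine (hR.preimage (f := fun q : (W × (ℕ → ℕ)) × (ℕ → ℕ) ↦ (q.1.1, q.2))
    (by fun_prop)).inter (IsClosed.inter ?_ ?_)
  · change IsClosed {q : (W × (ℕ → ℕ)) × (ℕ → ℕ) | ∀ m < n, q.2 m = q.1.2 m}
    simp only [Set.ofPred_forall]
    exact isClosed_iInter fun m ↦ isClosed_iInter fun _ ↦
      (isClosed_discrete {p : ℕ × ℕ | p.1 = p.2}).preimage (hcoord m)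
  · exact (isClosed_discrete {p : ℕ × ℕ | p.1 < p.2}).preimage (hcoord n)

/-- A `Σ¹₂` condition imposed on the lexicographically least element of a section of a closed
relation is `Σ¹₂`. -/
lemma sigma12_setOf_isLexMin {W : Type*} [TopologicalSpace W] [PolishSpace W] [Nonempty W]
    {R : Set (W × (ℕ → ℕ))} (hR : IsClosed R) {B : Set (ℕ → ℕ)} (hB : Sigma12 B)
    {s : W × (ℕ → ℕ) → ℕ → ℕ} (hs : Continuous s) :
    Sigma12 {x | ∃ v, IsLexMin {v | (x, v) ∈ R} v ∧ s (x, v) ∈ B} := by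
  obtain ⟨C, q, hC, hq, rfl⟩ := hB
  let D : Set ((W × (ℕ → ℕ)) × (ℕ → ℕ)) :=
    {p | IsLexMin {v | (p.1.1, v) ∈ R} p.1.2 ∧ p.2 ∈ C ∧ q p.2 = s p.1}
  have hD : AnalyticSet Dᶜ := by
    have heq : Dᶜ = Prod.fst ⁻¹' {p : W × (ℕ → ℕ) | IsLexMin {v | (p.1, v) ∈ R} p.2}ᶜ ∪
        (Prod.snd ⁻¹' Cᶜ ∪ {p | q p.2 = s p.1}ᶜ) := by
      ext p
      simp only [D, Set.mem_compl_iff, Set.mem_ofPred_eq, Set.mem_union, Set.mem_preimage,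
        not_and_or]
    rw [heq]
    borelize ((W × (ℕ → ℕ)) × (ℕ → ℕ))
    exact ((analyticSet_compl_isLexMin hR).preimage continuous_fst).union
      ((hC.preimage continuous_snd).union (isClosed_eq (hq.comp continuous_snd)
        (hs.comp continuous_fst)).measurableSet.compl.analyticSet)
  convert Sigma12.image hD (g := fun p ↦ p.1.1) (by fun_prop) using 1
  ext x
  simp only [D, Set.mem_ofPred_eq, Set.mem_image, Prod.exists]
  constructor
  · rintro ⟨v, hv, c, hc, hcv⟩
    exact ⟨x, v, c, ⟨hv, hc, hcv⟩, rfl⟩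
  · rintro ⟨_, v, c, ⟨hv, hc, hcv⟩, rfl⟩
    exact ⟨v, hv, c, hc, hcv⟩

/-- Any `(Σ¹₂,Σ¹₁∪Π¹₁)`-complete subset of a zero-dimensional Polish space (with a
fixed countable clopen subbase) is `Σ¹₂`-complete. -/
theorem statement8 (X : Type) [tX : TopologicalSpace X] [PolishSpace X]
    (hX : ZeroDim X) {ι : Type} [Countable ι] (U : ι → Set X)
    (hclopen : ∀ i, IsClopen (U i))
    (hgen : TopologicalSpace.generateFrom (Set.range U) = tX)
    (A : Set X) (hA : SubComplete U A) : Sigma12Complete A := by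
  refine ⟨hA.1, fun Z _ _ hZ B hB ↦ ?_⟩
  obtain ⟨φ, hφ, hφinj⟩ := hZ.exists_continuous_injective
  obtain ⟨O, hO, hcode⟩ := exists_codes_of_closed ((ℕ ⊕ List ℕ → ℕ) × (ℕ → ℕ))
  let R : Set ((ℕ ⊕ List ℕ → ℕ) × (ℕ → ℕ)) := {p | ∀ k, p.1 (Sum.inl k) = 0 → p ∉ O k}
  have hR : IsClosed R := by
    simp only [R, Set.ofPred_forall, imp_iff_not_or]
    refine isClosed_iInter fun k ↦ IsClosed.union ?_ (hO k).isClosed_compl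
    exact (isClosed_discrete ({0}ᶜ : Set ℕ)).preimage
      ((continuous_apply (A := fun _ : ℕ ⊕ List ℕ ↦ ℕ) _).comp continuous_fst)
  have hφB : Sigma12 (φ '' B) := by
    obtain ⟨C, q, hC, hq, rfl⟩ := hB
    exact ⟨C, φ ∘ q, hC, hφ.comp hq, Set.image_comp φ q C⟩
  obtain ⟨f, hf, hfA⟩ := hA.2 (ℕ ⊕ List ℕ → ℕ) (zeroDim_pi_nat _) _
    (sigma12_setOf_isLexMin hR hφB
      (s := fun p ↦ answers (fun L ↦ p.1 (Sum.inr L)) p.2)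
      (continuous_answers.comp
        (f := fun p : (ℕ ⊕ List ℕ → ℕ) × (ℕ → ℕ) ↦ (fun L ↦ p.1 (Sum.inr L), p.2))
        (by fun_prop)))
  have hor : ∀ i, ∃ S, AnalyticSet S ∧ (S = f ⁻¹' U i ∨ S = (f ⁻¹' U i)ᶜ) := fun i ↦
    (hf i).elim (fun h ↦ ⟨_, h, Or.inl rfl⟩) (fun h ↦ ⟨_, h, Or.inr rfl⟩)
  choose S hS hSU using hor
  obtain ⟨Q, j, hQ, hQne, hQj⟩ := exists_isClosed_isLexMin_decides hS
  obtain ⟨w, hw⟩ := hcode Q hQ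
  have hcont : Continuous fun σ : List ℕ → ℕ ↦ (Sum.elim w σ : ℕ ⊕ List ℕ → ℕ) :=
    continuous_pi (Sum.rec (fun _ ↦ continuous_const) fun L ↦ continuous_apply L)
  have hRQ : ∀ σ : List ℕ → ℕ, {v | (Sum.elim w σ, v) ∈ R} = {v | (Sum.elim w σ, v) ∈ Q} :=
    fun σ ↦ Set.ext fun v ↦ (hw (Sum.elim w σ, v)).symm
  obtain ⟨G, V, hG, hV, hGV⟩ := exists_continuous_isLexMin
    (Q := {p | (Sum.elim w p.1, p.2) ∈ Q})
    (hQ.preimage (f := fun p : (List ℕ → ℕ) × (ℕ → ℕ) ↦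
      ((Sum.elim w p.1 : ℕ ⊕ List ℕ → ℕ), p.2))
      ((hcont.comp continuous_fst).prodMk continuous_snd)) fun σ ↦ hQne (Sum.elim w σ)
  refine ⟨fun z ↦ f (Sum.elim w (G (φ z))), ?_, ?_⟩
  · rw [← hgen]
    refine continuous_generateFrom_iff.2 ?_
    rintro _ ⟨i, rfl⟩
    have hVi : Continuous fun z ↦ V (φ z) (j i) := (continuous_apply _).comp (hV.comp hφ)
    have hiff : ∀ z, V (φ z) (j i) = 0 ↔ Sum.elim w (G (φ z)) ∈ S i := fun z ↦
      hQj _ _ (hGV (φ z)).1 i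
    rcases hSU i with h | h
    · convert (isOpen_discrete ({0} : Set ℕ)).preimage hVi using 1
      ext z
      simpa [h] using (hiff z).symm
    · convert (isOpen_discrete ({0}ᶜ : Set ℕ)).preimage hVi using 1
      ext z
      simpa [h, not_iff_comm] using (not_congr (hiff z)).symm
  · ext z
    have hz : Sum.elim w (G (φ z)) ∈ f ⁻¹' A ↔ φ z ∈ φ '' B := by
      rw [hfA]
      simp only [Set.mem_ofPred_eq, hRQ, Sum.elim_inr]
      refine ⟨fun ⟨v, hv, hvB⟩ ↦ ?_, fun h ↦ ⟨V (φ z), (hGV (φ z)).1, ?_⟩⟩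
      · rwa [hv.unique (hGV (φ z)).1, (hGV (φ z)).2] at hvB
      · rwa [(hGV (φ z)).2]
    exact hz.trans hφinj.mem_set_image
end

section
/- Let X and Y be zero-dimensional Polish spaces with fixed countable clopen subbases, let A ⊆ X be (Σ¹₂,Σ¹₁∪Π¹₁)-complete, and let C ⊆ Y be Σ¹₂-complete. If Y has a (Σ¹₂,Σ¹₁∪Π¹₁)-expansion, then A is Σ¹₂-complete. -/
open MeasureTheory TopologicalSpace

/-- `f` into the Cantor space is `Σ¹₁∪Π¹₁`-submeasurable (w.r.t. the standard
subbase `{x : x(n) = i}`): each such preimage is analytic or coanalytic. -/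
def CantorSubmeasurable {Z : Type*} [TopologicalSpace Z] (f : Z → (ℕ → Bool)) : Prop :=
  ∀ (n : ℕ) (i : Bool),
    AnalyticSet (f ⁻¹' {x | x n = i}) ∨ AnalyticSet (f ⁻¹' {x | x n = i})ᶜ

/-- A `(Σ¹₂,Σ¹₁∪Π¹₁)`-expansion of a Polish space `Y`: a Polish space `Y'`, a `Σ¹₂`
set `E ⊆ Y'` and a `Σ¹₂`-measurable map `r : E → Y` such that every
`Σ¹₁∪Π¹₁`-submeasurable `f : Y' → 2^ℕ` factors continuously through `r` on a closed
subset of `E` mapping onto `Y`. -/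
def HasExpansion (Y : Type) [TopologicalSpace Y] : Prop :=
  ∃ (Y' : Type) (_ : TopologicalSpace Y') (_ : PolishSpace Y')
    (E : Set Y') (r : Y' → Y),
      Sigma12 E ∧
      (∀ V : Set Y, IsOpen V → ∃ S, Sigma12 S ∧ r ⁻¹' V ∩ E = S ∩ E) ∧
      ∀ f : Y' → (ℕ → Bool), CantorSubmeasurable f →
        ∃ (F : Set Y') (g : Y → (ℕ → Bool)),
          F ⊆ E ∧ IsClosed F ∧ Continuous g ∧ r '' F = Set.univ ∧
          ∀ w ∈ F, g (r w) = f w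

/-- Continuous images of coanalytic subsets of an arbitrary nonempty Polish space are `Σ¹₂`. -/
theorem Sigma12.image_of_coanalytic {P X : Type*} [TopologicalSpace P] [PolishSpace P] [Nonempty P]
    [TopologicalSpace X] {D : Set P} (hD : AnalyticSet Dᶜ) {k : P → X} (hk : Continuous k) :
    Sigma12 (k '' D) := by
  obtain ⟨q, hq, hqs⟩ := PolishSpace.exists_nat_nat_continuous_surjective P
  refine ⟨q ⁻¹' D, k ∘ q, hD.preimage hq, hk.comp hq, ?_⟩
  rw [Set.image_comp, Set.image_preimage_eq _ hqs]

/-- The preimage of a `Σ¹₂` set under the composition of a `Σ¹₂`-measurable map, defined on a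
`Σ¹₂` set, with a Borel map is `Σ¹₂`. -/
theorem Sigma12.preimage_comp_inter {Z W Y : Type*} [TopologicalSpace Z] [PolishSpace Z] [Nonempty Z]
    [MeasurableSpace Z] [BorelSpace Z] [TopologicalSpace W] [PolishSpace W] [MeasurableSpace W]
    [BorelSpace W] [TopologicalSpace Y] [PolishSpace Y] {E : Set W} (hE : Sigma12 E) {r : W → Y}
    (hr : ∀ V : Set Y, IsOpen V → ∃ S, Sigma12 S ∧ r ⁻¹' V ∩ E = S ∩ E)
    {C : Set Y} (hC : Sigma12 C) {φ : Z → W} (hφ : Measurable φ) :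
    Sigma12 (φ ⁻¹' (r ⁻¹' C ∩ E)) := by
  obtain ⟨CE, fE, hCE, hfE, rfl⟩ := hE
  obtain ⟨D, fC, hD, hfC, rfl⟩ := hC
  obtain ⟨V, hVc, -, hV⟩ := exists_countable_basis Y
  have : Countable V := hVc
  choose S hS hSE using fun v : V => hr v (hV.isOpen v.2)
  choose CS fS hCS hfS hfSE using hS
  let P := Z × (ℕ → ℕ) × (ℕ → ℕ) × (V → ℕ → ℕ)
  let T : Set P := {p | ¬ (p.2.1 ∉ CE ∨ p.2.2.1 ∉ D ∨ ¬ fE p.2.1 = φ p.1 ∨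
    ∃ v : V, fC p.2.2.1 ∈ v.1 ∧ (p.2.2.2 v ∉ CS v ∨ ¬ fS v (p.2.2.2 v) = φ p.1))}
  have hT : AnalyticSet Tᶜ := by
    have e : Tᶜ = ⋃ i : Option (Option (Option V)), (match i with
        | none => (fun p : P => p.2.1) ⁻¹' CEᶜ
        | some none => (fun p : P => p.2.2.1) ⁻¹' Dᶜ
        | some (some none) => {p : P | fE p.2.1 = φ p.1}ᶜ
        | some (some (some v)) => (fun p : P => fC p.2.2.1) ⁻¹' v.1 ∩
            ⋃ b : Bool, bif b then (fun p : P => p.2.2.2 v) ⁻¹' (CS v)ᶜ else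
              {p : P | fS v (p.2.2.2 v) = φ p.1}ᶜ : Set P) := by
      ext p
      simp only [T, Set.compl_ofPred, not_not, Set.mem_iUnion, Option.exists, Bool.exists_bool,
        Set.mem_ofPred_eq, Set.mem_inter_iff, Set.mem_preimage, Set.mem_compl_iff, cond_true,
        cond_false, or_comm (a := _ ∉ CS _)]
    borelize P
    have hfst : Measurable fun p : P => φ p.1 := hφ.comp continuous_fst.measurable
    rw [e]
    refine AnalyticSet.iUnion fun i => ?_
    rcases i with _ | _ | _ | v
    · exact hCE.preimage (by fun_prop)
    · exact hD.preimage (by fun_prop)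
    · exact (measurableSet_eq_fun (hfE.comp (by fun_prop)).measurable hfst).compl.analyticSet
    · dsimp only
      rw [Set.inter_eq_iInter]
      refine AnalyticSet.iInter fun c => ?_
      cases c
      on_goal 2 => exact ((hV.isOpen v.2).preimage (by fun_prop)).measurableSet.analyticSet
      refine AnalyticSet.iUnion fun b => ?_
      cases b
      · exact (measurableSet_eq_fun ((hfS v).comp (by fun_prop)).measurable hfst).compl.analyticSet
      · exact (hCS v).preimage (by fun_prop)
  convert Sigma12.image_of_coanalytic hT (k := Prod.fst) continuous_fst using 1
  ext z
  constructor
  · rintro ⟨⟨d, hd, hdz⟩, ⟨a, ha, haz⟩⟩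
    have key (v : V) : ∃ x, fC d ∈ v.1 → x ∈ CS v ∧ fS v x = φ z := by
      by_cases hv : fC d ∈ v.1
      · have hz : φ z ∈ S v ∩ fE '' CE := by
          rw [← hSE]
          exact ⟨by simpa [← hdz] using hv, a, ha, haz⟩
        rw [← hfSE] at hz
        obtain ⟨⟨x, hx, hxz⟩, -⟩ := hz
        exact ⟨x, fun _ => ⟨hx, hxz⟩⟩
      · exact ⟨0, fun h => absurd h hv⟩
    choose x hx using key
    refine ⟨(z, a, d, x), ?_, rfl⟩
    simp only [T, Set.mem_ofPred_eq]
    push Not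
    exact ⟨ha, hd, haz, hx⟩
  · rintro ⟨⟨z, a, d, x⟩, hp, rfl⟩
    simp only [T, Set.mem_ofPred_eq] at hp
    push Not at hp
    obtain ⟨ha, hd, haz, hx⟩ := hp
    have hzE : φ z ∈ fE '' CE := ⟨a, ha, haz⟩
    refine ⟨⟨d, hd, ?_⟩, hzE⟩
    by_contra hne
    obtain ⟨O, O', hO, hO', hdO, hzO', hdisj⟩ := t2_separation hne
    obtain ⟨v, hv, hdv, hvO⟩ := hV.exists_subset_of_mem_open hdO hO
    have hzS : φ z ∈ S ⟨v, hv⟩ ∩ fE '' CE := by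
      rw [← hfSE]
      exact ⟨⟨_, hx ⟨v, hv⟩ hdv⟩, hzE⟩
    rw [← hSE] at hzS
    exact hdisj.le_bot ⟨hvO hzS.1, hzO'⟩

theorem zeroDim_of_discreteTopology {Z : Type*} [TopologicalSpace Z] [DiscreteTopology Z] :
    ZeroDim Z :=
  ⟨_, fun _ _ => isClopen_discrete _, isTopologicalBasis_opens⟩

theorem zeroDim_cantor : ZeroDim (ℕ → Bool) :=
  ⟨_, fun _ h => h, loc_compact_Haus_tot_disc_of_zero_dim⟩

/-- Every Polish space is Borel isomorphic to a zero-dimensional one. -/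
theorem exists_zeroDim_measurableEquiv (W : Type) [TopologicalSpace W] [PolishSpace W]
    [MeasurableSpace W] [BorelSpace W] :
    ∃ (Z : Type) (_ : TopologicalSpace Z) (_ : PolishSpace Z) (_ : MeasurableSpace Z)
      (_ : BorelSpace Z), ZeroDim Z ∧ Nonempty (Z ≃ᵐ W) := by
  by_cases h : Countable W
  · obtain ⟨e, he⟩ := exists_injective_nat W
    exact ⟨Set.range e, inferInstance, (isClosed_discrete _).polishSpace, inferInstance,
      inferInstance, zeroDim_of_discreteTopology,
      ⟨⟨(Equiv.ofInjective e he).symm, measurable_of_countable _, measurable_of_countable _⟩⟩⟩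
  · have : IsCompletelyMetrizableSpace (ℕ → Bool) := .pi_countable
    have : PolishSpace (ℕ → Bool) := { }
    exact ⟨ℕ → Bool, _, this, _, inferInstance, zeroDim_cantor,
      ⟨(PolishSpace.measurableEquivNatBoolOfNotCountable h).symm⟩⟩

/-- Analytic sets are stable under Borel maps between Polish spaces. -/
theorem MeasureTheory.AnalyticSet.image_of_measurable {Z W : Type*} [TopologicalSpace Z]
    [MeasurableSpace Z] [BorelSpace Z] [TopologicalSpace W] [PolishSpace W] [MeasurableSpace W]
    [BorelSpace W] {s : Set Z} (hs : AnalyticSet s) {φ : Z → W} (hφ : Measurable φ) :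
    AnalyticSet (φ '' s) := by
  rw [AnalyticSet] at hs
  rcases hs with rfl | ⟨q, hq, rfl⟩
  · simpa using analyticSet_empty
  · rw [← Set.image_univ, ← Set.image_comp]
    exact MeasurableSet.univ.analyticSet_image (hφ.comp hq.measurable)

/-- Submeasurability transfers along Borel isomorphisms. -/
theorem Submeasurable.comp_measurableEquiv_symm {Z W X ι : Type*} [TopologicalSpace Z]
    [MeasurableSpace Z] [BorelSpace Z] [TopologicalSpace W] [PolishSpace W]
    [MeasurableSpace W] [BorelSpace W] {U : ι → Set X} {f : Z → X} (hf : Submeasurable U f)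
    (φ : Z ≃ᵐ W) : Submeasurable U (f ∘ φ.symm) := by
  intro i
  have e (s : Set Z) : φ.symm ⁻¹' s = φ '' s := (φ.image_eq_preimage_symm s).symm
  rw [Set.preimage_comp, ← Set.preimage_compl, e, e]
  exact (hf i).imp (·.image_of_measurable φ.measurable)
    (·.image_of_measurable φ.measurable)

/-- If `A ⊆ X` is `(Σ¹₂,Σ¹₁∪Π¹₁)`-complete, `C ⊆ Y` is `Σ¹₂`-complete and `Y` has a
`(Σ¹₂,Σ¹₁∪Π¹₁)`-expansion, then `A` is `Σ¹₂`-complete. -/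
theorem statement10 (X Y : Type)
    [tX : TopologicalSpace X] [PolishSpace X] (hX : ZeroDim X)
    [tY : TopologicalSpace Y] [PolishSpace Y] (hY : ZeroDim Y)
    {ι : Type} [Countable ι] (U : ι → Set X) (hclopen : ∀ i, IsClopen (U i))
    (hgen : TopologicalSpace.generateFrom (Set.range U) = tX)
    {ι' : Type} [Countable ι'] (U' : ι' → Set Y) (hclopen' : ∀ i, IsClopen (U' i))
    (hgen' : TopologicalSpace.generateFrom (Set.range U') = tY)
    (A : Set X) (hA : SubComplete U A)
    (C : Set Y) (hC : Sigma12Complete C)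
    (hexp : HasExpansion Y) : Sigma12Complete A := by

  refine ⟨hA.1, fun Z _ _ hZ B hB => ?_⟩
  obtain ⟨h, hh, hhB⟩ := hC.2 Z hZ B hB
  suffices ∃ g : Y → X, Continuous g ∧ g ⁻¹' A = C by
    obtain ⟨g, hg, hgA⟩ := this
    exact ⟨g ∘ h, hg.comp hh, by rw [Set.preimage_comp, hgA, hhB]⟩
  obtain ⟨Y', _, _, E, r, hE, hr, hfact⟩ := hexp
  borelize Y'
  obtain ⟨Z', _, _, _, _, hZ', ⟨φ⟩⟩ := exists_zeroDim_measurableEquiv Y'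
  have : Nonempty Z' := by
    obtain ⟨_, k, -⟩ := hE
    exact ⟨φ.symm (k 0)⟩
  obtain ⟨f₀, hf₀, hf₀A⟩ :=
    hA.2 Z' hZ' _ (Sigma12.preimage_comp_inter hE hr hC.1 φ.measurable)
  have hf := hf₀.comp_measurableEquiv_symm φ
  set f : Y' → X := f₀ ∘ φ.symm
  have hfA : f ⁻¹' A = r ⁻¹' C ∩ E := by
    rw [Set.preimage_comp, hf₀A, ← Set.preimage_comp]
    simp
  classical
  have := Encodable.ofCountable ι
  obtain ⟨F, g, hFE, -, hg, hrF, hgf⟩ := hfact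
    (fun w n => decide (∃ i, Encodable.encode i = n ∧ f w ∈ U i)) (by
      intro n b
      suffices ∀ T : Set Y', T = {w | ∃ i, Encodable.encode i = n ∧ f w ∈ U i} →
          AnalyticSet T ∨ AnalyticSet Tᶜ by
        have := this _ rfl
        cases b
        · simpa [Set.preimage, Set.compl_def, or_comm] using this
        · simpa [Set.preimage, Set.compl_def] using this
      rintro T rfl
      by_cases hn : ∃ i : ι, Encodable.encode i = n
      · obtain ⟨i, rfl⟩ := hn
        simpa [Set.preimage] using hf i
      · left
        convert analyticSet_empty
        ext w
        simp only [Set.mem_ofPred_eq, Set.mem_empty_iff_false, iff_false]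
        exact fun ⟨i, hi, _⟩ => hn ⟨i, hi⟩)
  have hsurj (y : Y) : ∃ w ∈ F, r w = y := by
    have : y ∈ r '' F := hrF ▸ Set.mem_univ y
    exact this
  choose s hsF hs using hsurj
  refine ⟨f ∘ s, ?_, ?_⟩
  · subst hgen
    refine continuous_generateFrom_iff.2 ?_
    rintro _ ⟨i, rfl⟩
    have e : f ∘ s ⁻¹' U i = (fun y => g y (Encodable.encode i)) ⁻¹' {true} := by
      ext y
      have := congrFun (hgf (s y) (hsF y)) (Encodable.encode i)
      rw [hs] at this
      simp [this]
    rw [e]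
    exact (isOpen_discrete _).preimage ((continuous_apply _).comp hg)
  · ext y
    rw [Set.preimage_comp, hfA]
    simp [hs, hFE (hsF y)]
end

section
/- There exist a Σ¹₂ set R ⊆ 2^ℕ and a Σ¹₂-measurable function T : R → P(2^{<ℕ}) such that for every partition of 2^ℕ × 2^ℕ into a disjoint union of an analytic set A and a coanalytic set C, there exists x ∈ R with lim T(x) ⊆ A_x or lim T(x) ⊆ C_x, where A_x = {y ∈ 2^ℕ : (x,y) ∈ A} and C_x = {y ∈ 2^ℕ : (x,y) ∈ C}. -/
open MeasureTheory TopologicalSpace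

/-- A perfect binary tree: nonempty, closed under initial segments, and every
member has two incomparable extensions in the tree. -/
def PerfectBinTree (T : List Bool → Bool) : Prop :=
  T [] = true ∧
  (∀ l b, T (l ++ [b]) = true → T l = true) ∧
  ∀ l, T l = true → ∃ l₁ l₂, T l₁ = true ∧ T l₂ = true ∧ l <+: l₁ ∧ l <+: l₂ ∧
    ¬ l₁ <+: l₂ ∧ ¬ l₂ <+: l₁

/-- `lim T ⊆ 2^ℕ`: the set of infinite branches of `T`. -/
def limTree (T : List Bool → Bool) : Set (ℕ → Bool) :=
  {x | ∀ k, T ((List.range k).map x) = true}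

namespace StageComparison

open Set

variable {N : Type*}

/-- The operator whose least fixed point compares the stages at which two elements enter the
inductive construction given by `Ψ`. -/
def stageOp (Ψ : Set N →o Set N) : Set (N × N) →o Set (N × N) where
  toFun L := {c | c.1 ∈ Ψ {n | c.2 ∉ Ψ {k | (n, k) ∉ L}}}
  monotone' L L' h := by
    rintro ⟨n, m⟩ hn
    refine Ψ.mono ?_ hn
    intro n' hn' hm
    exact hn' (Ψ.mono (fun k (hk : (n', k) ∉ L') hk' => hk (h hk')) hm)

/-- The stages of the inductive construction given by `Ψ`. -/
abbrev stage (Ψ : Set N →o Set N) (a : Ordinal) : Set N := OrdinalApprox.lfpApprox Ψ ⊥ a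

variable (Ψ : Set N →o Set N)

theorem mem_stage_iff {a : Ordinal} {n : N} : n ∈ stage Ψ a ↔ ∃ b < a, n ∈ Ψ (stage Ψ b) := by
  rw [stage, OrdinalApprox.lfpApprox]
  simp [stage]

theorem mem_lfp_iff {n : N} : n ∈ Ψ.lfp ↔ ∃ a, n ∈ Ψ (stage Ψ a) := by
  constructor
  · intro h
    have := OrdinalApprox.lfp_mem_range_lfpApprox Ψ
    obtain ⟨a, ha⟩ := this
    refine ⟨a, ?_⟩
    rw [stage, ha, Ψ.map_lfp]
    exact h
  · rintro ⟨a, ha⟩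
    rw [← Ψ.map_lfp]
    refine Ψ.mono ?_ ha
    exact OrdinalApprox.lfpApprox_le_of_mem_fixedPoints Ψ Ψ.map_lfp bot_le a

theorem mem_stageOp_lfp {a : Ordinal} {n m : N} (hn : n ∈ Ψ (stage Ψ a)) (hm : m ∉ stage Ψ a) :
    (n, m) ∈ (stageOp Ψ).lfp := by
  induction a using WellFoundedLT.induction generalizing n m with
  | ind a ih =>
    rw [← (stageOp Ψ).map_lfp]
    refine Ψ.mono ?_ hn
    intro n' hn' hm'
    obtain ⟨b, hb, hnb⟩ := (mem_stage_iff Ψ).1 hn'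
    refine hm ((mem_stage_iff Ψ).2 ⟨b, hb, Ψ.mono ?_ hm'⟩)
    intro k hk
    by_contra hkb
    exact hk (ih b hb hnb hkb)

theorem of_mem_stageOp_lfp (hΨ : Ψ univ = univ) {n m : N} (h : (n, m) ∈ (stageOp Ψ).lfp) :
    n ∈ Ψ.lfp ∧ ∀ a, m ∈ Ψ (stage Ψ a) → n ∈ Ψ (stage Ψ a) := by
  let L : Set (N × N) := {c | c.1 ∈ Ψ.lfp ∧ ∀ a, c.2 ∈ Ψ (stage Ψ a) → c.1 ∈ Ψ (stage Ψ a)}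
  suffices hL : (stageOp Ψ).lfp ≤ L from hL h
  refine (stageOp Ψ).lfp_le ?_
  rintro ⟨n, m⟩ hn
  change n ∈ Ψ {n' | m ∉ Ψ {k | (n', k) ∉ L}} at hn
  refine ⟨?_, fun a hm => Ψ.mono ?_ hn⟩
  · rw [← Ψ.map_lfp]
    refine Ψ.mono ?_ hn
    intro n' hn'
    by_contra hI
    apply hn'
    have : {k | (n', k) ∉ L} = univ := eq_univ_of_forall fun k hk => hI hk.1
    rw [this, hΨ]
    trivial
  · intro n' hn'
    by_contra hna
    refine hn' (Ψ.mono ?_ hm)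
    intro k hk hkL
    obtain ⟨b, hb, hkb⟩ := (mem_stage_iff Ψ).1 hk
    exact hna ((mem_stage_iff Ψ).2 ⟨b, hb, hkL.2 b hkb⟩)

/-- Every set meeting the least fixed point has an element of minimal stage. -/
theorem exists_minimal (hΨ : Ψ univ = univ) {B : Set N} (hB : (B ∩ Ψ.lfp).Nonempty) :
    ∃ n ∈ B, (∀ m ∈ B, (n, m) ∈ (stageOp Ψ).lfp) ∧ n ∈ Ψ {q | (n, q) ∉ (stageOp Ψ).lfp} := by
  have hne : {a : Ordinal | ∃ n ∈ B, n ∈ Ψ (stage Ψ a)}.Nonempty := by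
    obtain ⟨n, hn, hI⟩ := hB
    obtain ⟨a, ha⟩ := (mem_lfp_iff Ψ).1 hI
    exact ⟨a, n, hn, ha⟩
  obtain ⟨a, ⟨n, hn, hna⟩, hmin⟩ := WellFounded.has_min (wellFounded_lt (α := Ordinal)) _ hne
  refine ⟨n, hn, fun m hm => mem_stageOp_lfp Ψ hna ?_, Ψ.mono ?_ hna⟩
  · intro hma
    obtain ⟨b, hb, hmb⟩ := (mem_stage_iff Ψ).1 hma
    exact hmin b ⟨m, hm, hmb⟩ hb
  · intro q hq hL
    obtain ⟨b, hb, hqb⟩ := (mem_stage_iff Ψ).1 hq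
    exact hmin b ⟨n, hn, (of_mem_stageOp_lfp Ψ hΨ hL).2 b hqb⟩ hb

theorem diag_mem_stageOp_lfp_iff (hΨ : Ψ univ = univ) {n : N} :
    (n, n) ∈ (stageOp Ψ).lfp ↔ n ∈ Ψ.lfp := by
  refine ⟨fun h => (of_mem_stageOp_lfp Ψ hΨ h).1, fun h => ?_⟩
  obtain ⟨m, rfl, hm, -⟩ := exists_minimal Ψ hΨ (B := {n}) ⟨n, rfl, h⟩
  exact hm m rfl

end StageComparison

namespace StageComparison

open Set

variable {X : Type*}

instance polishSpace_bool_fun {N : Type*} [Countable N] : PolishSpace (N → Bool) where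

theorem sigma12_image {Y : Type*} [TopologicalSpace X] [TopologicalSpace Y] [PolishSpace Y]
    [Nonempty Y] {C : Set Y} (hC : AnalyticSet Cᶜ) {f : Y → X} (hf : Continuous f) :
    Sigma12 (f '' C) := by
  obtain ⟨g, hg, hsurj⟩ := PolishSpace.exists_nat_nat_continuous_surjective Y
  refine ⟨g ⁻¹' C, f ∘ g, ?_, hf.comp hg, ?_⟩
  · rw [← preimage_compl]
    exact hC.preimage hg
  · rw [image_comp, image_preimage_eq _ hsurj]

/-- The graph of the least fixed point of a Borel family of monotone operators is coanalytic. -/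
theorem analyticSet_lfp_graph_compl {N : Type*} [Countable N] [TopologicalSpace X]
    [PolishSpace X] [MeasurableSpace X] [BorelSpace X] (Θ : X → Set N →o Set N)
    (hΘ : Measurable fun p : X × (N → Bool) => Θ p.1 {n | p.2 n = true}) :
    AnalyticSet {p : X × (N → Bool) | {n | p.2 n = true} = (Θ p.1).lfp}ᶜ := by
  have hΘ' : ∀ n, Measurable fun p : X × (N → Bool) => n ∈ Θ p.1 {n | p.2 n = true} :=
    measurable_set_iff.1 hΘ
  have hb : ∀ n, Measurable fun p : X × (N → Bool) => p.2 n = true := by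
    intro n
    apply measurableSet_setOfPred.1
    exact measurableSet_eq_fun ((measurable_pi_apply n).comp measurable_snd) measurable_const
  have hc : MeasurableSet
      {p : X × (N → Bool) | ∀ n, n ∈ Θ p.1 {n | p.2 n = true} → p.2 n = true} :=
    measurableSet_setOfPred.2 (.forall fun n => (hΘ' n).imp (hb n))
  let π : (X × (N → Bool)) × (N → Bool) → X × (N → Bool) := fun q => (q.1.1, q.2)
  have hπ : Measurable π := by fun_prop
  have hd : MeasurableSet {q : (X × (N → Bool)) × (N → Bool) |
      π q ∈ {p : X × (N → Bool) | ∀ n, n ∈ Θ p.1 {n | p.2 n = true} → p.2 n = true} ∧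
        ¬ ∀ n, q.1.2 n = true → q.2 n = true} := by
    refine (hπ hc).inter (measurableSet_setOfPred.2 (Measurable.not (.forall fun n => ?_)))
    exact ((hb n).comp measurable_fst).imp ((hb n).comp hπ)
  have key : {p : X × (N → Bool) | {n | p.2 n = true} = (Θ p.1).lfp}ᶜ =
      {p : X × (N → Bool) | ∀ n, n ∈ Θ p.1 {n | p.2 n = true} → p.2 n = true}ᶜ ∪
      Prod.fst '' {q : (X × (N → Bool)) × (N → Bool) |
      π q ∈ {p : X × (N → Bool) | ∀ n, n ∈ Θ p.1 {n | p.2 n = true} → p.2 n = true} ∧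
        ¬ ∀ n, q.1.2 n = true → q.2 n = true} := by
    rw [← compl_inj_iff, compl_compl, compl_union, compl_compl]
    ext ⟨x, Z⟩
    constructor
    · intro h
      change {n | Z n = true} = (Θ x).lfp at h
      refine ⟨?_, ?_⟩
      · intro n hn
        change n ∈ Θ x {n | Z n = true} at hn
        rw [h, (Θ x).map_lfp, ← h] at hn
        exact hn
      · rintro ⟨⟨⟨x', Z'⟩, Z''⟩, ⟨h1, h2⟩, heq⟩
        obtain ⟨rfl, rfl⟩ := Prod.mk.inj heq
        apply h2
        intro n hn
        have hn' : n ∈ (Θ x').lfp := by rw [← h]; exact hn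
        exact (Θ x').lfp_le (a := {n | Z'' n = true}) h1 hn'
    · rintro ⟨h1, h2⟩
      refine Subset.antisymm ?_ ((Θ x).lfp_le h1)
      refine (Θ x).le_lfp fun S hS => ?_
      by_contra hcon
      classical
      refine h2 ⟨((x, Z), fun n => decide (n ∈ S)), ⟨?_, ?_⟩, rfl⟩
      · intro n hn
        simpa [π] using hS (by simpa [π] using hn)
      · intro h
        exact hcon fun n hn => by simpa using h n hn
  rw [key]
  have h1 := hc.compl.analyticSet
  have h2 := hd.analyticSet.image_of_continuous
    (continuous_fst (X := X × (N → Bool)) (Y := N → Bool))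
  rw [union_eq_iUnion]
  exact AnalyticSet.iUnion fun b => by cases b <;> assumption

end StageComparison

namespace PerfectSubtree

open Set

/-- The initial segment of length `k` of the sequence `w`. -/
abbrev initSeg {α : Type*} (w : ℕ → α) (k : ℕ) : List α := (List.range k).map w

theorem initSeg_isPrefix {α : Type*} (w : ℕ → α) {j k : ℕ} (h : j ≤ k) :
    initSeg w j <+: initSeg w k := by
  obtain ⟨i, rfl⟩ := Nat.exists_eq_add_of_le h
  rw [initSeg, initSeg, List.range_add, List.map_append]
  exact List.prefix_append _ _

theorem eq_initSeg_of_isPrefix {α : Type*} {w : ℕ → α} {p : List α} {k : ℕ}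
    (h : p <+: initSeg w k) : p = initSeg w p.length := by
  have hle : p.length ≤ k := by simpa using h.length_le
  refine List.IsPrefix.eq_of_length (List.prefix_of_prefix_length_le h (initSeg_isPrefix w hle) ?_) ?_
    <;> simp

theorem take_initSeg {α : Type*} (w : ℕ → α) {j k : ℕ} (h : j ≤ k) :
    (initSeg w k).take j = initSeg w j := by
  have := eq_initSeg_of_isPrefix (w := w) (k := k)
    ⟨_, List.take_append_drop j _⟩
  rwa [List.length_take, List.length_map, List.length_range, min_eq_left h] at this

/-- Finite sequences of pairs, seen as finite approximations to pairs of sequences. -/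
abbrev Node := List (Bool × ℕ)

/-- The sequence of first coordinates. -/
abbrev fsts (p : Node) : List Bool := p.map Prod.fst

/-- Neither list is an initial segment of the other. -/
def Incomp (a b : List Bool) : Prop := ¬ a <+: b ∧ ¬ b <+: a

/-- The pair `c` of elements of `P` splits `p` in the first coordinate. -/
def Splits (P : Set Node) (p : Node) (c : Node × Node) : Prop :=
  c.1 ∈ P ∧ c.2 ∈ P ∧ p <+: c.1 ∧ p <+: c.2 ∧ Incomp (fsts c.1) (fsts c.2)

/-- The nodes of `P` which split inside `P`. -/
def splitting (P : Set Node) : Set Node := {p | p ∈ P ∧ ∃ c, Splits P p c}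

theorem splitting_mono : Monotone splitting := by
  rintro P Q h p ⟨hp, c, h1, h2, h3⟩
  exact ⟨h hp, c, h h1, h h2, h3⟩

/-- The operator adding to the set `Q` of removed nodes those no longer splitting in `S \ Q`. -/
def removeOp (S : Set Node) : Set Node →o Set Node where
  toFun Q := (splitting (S \ Q))ᶜ
  monotone' _ _ h := compl_subset_compl.2 (splitting_mono (sdiff_subset_sdiff_right h))

theorem removeOp_univ (S : Set Node) : removeOp S univ = univ := by
  refine eq_univ_of_forall fun p hp => ?_
  exact hp.1.2 trivial

theorem lfp_removeOp_compl (S : Set Node) :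
    (removeOp S).lfpᶜ = splitting (S \ (removeOp S).lfp) := by
  conv_lhs => rw [← (removeOp S).map_lfp]
  exact compl_compl _

/-- The projection to the first coordinate of the set of branches of `S`. -/
def projBranches (S : Set Node) : Set (ℕ → Bool) :=
  {y | ∃ w : ℕ → Bool × ℕ, (∀ k, initSeg w k ∈ S) ∧ ∀ i, (w i).1 = y i}

section Pick

variable {α : Type*} [Encodable α] [Inhabited α]

/-- The element of `Q` with least code. -/
noncomputable def pick (Q : Set α) : α :=
  (Encodable.decode (sInf {i | ∃ a ∈ Q, Encodable.encode a = i})).getD default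

theorem pick_mem {Q : Set α} (h : Q.Nonempty) : pick Q ∈ Q := by
  obtain ⟨a, ha⟩ := h
  obtain ⟨b, hb, hb'⟩ := Nat.sInf_mem (s := {i | ∃ a ∈ Q, Encodable.encode a = i}) ⟨_, a, ha, rfl⟩
  rw [pick, ← hb']
  simpa using hb

theorem measurable_sInf_nat {X : Type*} [MeasurableSpace X] {s : X → Set ℕ}
    (hs : ∀ i, Measurable fun x => i ∈ s x) (i : ℕ) : Measurable fun x => sInf (s x) = i := by
  have : (fun x => sInf (s x) = i) = fun x =>
      (i ∈ s x ∧ ∀ j, j < i → j ∉ s x) ∨ (i = 0 ∧ ∀ j, j ∉ s x) := by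
    ext x
    constructor
    · intro h
      by_cases hne : (s x).Nonempty
      · left
        subst h
        exact ⟨Nat.sInf_mem hne, fun j hj => Nat.notMem_of_lt_sInf hj⟩
      · rw [not_nonempty_iff_eq_empty] at hne
        right
        rw [hne, Nat.sInf_empty] at h
        simp [h, hne]
    · rintro (⟨h1, h2⟩ | ⟨rfl, h⟩)
      · refine le_antisymm (Nat.sInf_le h1) ?_
        by_contra! hlt
        exact h2 _ hlt (Nat.sInf_mem ⟨i, h1⟩)
      · rw [eq_empty_of_forall_notMem h, Nat.sInf_empty]
  rw [this]
  exact ((hs i).and (.forall fun j => .imp measurable_const (hs j).not)).or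
    (measurable_const.and (.forall fun j => (hs j).not))

theorem measurable_pick {X : Type*} [MeasurableSpace X] {Q : X → Set α}
    (hQ : ∀ a, Measurable fun x => a ∈ Q x) (a : α) : Measurable fun x => pick (Q x) = a := by
  have : (fun x => pick (Q x) = a) = fun x => ∃ i,
      sInf {i | ∃ a ∈ Q x, Encodable.encode a = i} = i ∧
        (Encodable.decode (α := α) i).getD default = a := by
    ext x
    simp [pick]
  rw [this]
  refine .exists fun i => .and (measurable_sInf_nat (fun j => ?_) i) measurable_const
  exact .exists fun b => (hQ b).and measurable_const

end Pick

section Scheme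

/-- The Cantor scheme of nodes of `P` obtained by repeatedly picking a splitting pair;
the binary sequence indexing a node is read from right to left. -/
noncomputable def scheme (P : Set Node) : List Bool → Node
  | [] => pick P
  | b :: l => if b then (pick {c | Splits P (scheme P l) c}).2
      else (pick {c | Splits P (scheme P l) c}).1

variable {P : Set Node}

theorem scheme_mem (hne : P.Nonempty) (hP : P ⊆ splitting P) (l : List Bool) :
    scheme P l ∈ P := by
  induction l with
  | nil => exact pick_mem hne
  | cons b l ih =>
    have := pick_mem (Q := {c | Splits P (scheme P l) c}) (hP ih).2
    cases b
    · exact this.1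
    · exact this.2.1

theorem splits_scheme (hne : P.Nonempty) (hP : P ⊆ splitting P) (l : List Bool) :
    Splits P (scheme P l) (scheme P (false :: l), scheme P (true :: l)) :=
  pick_mem (Q := {c | Splits P (scheme P l) c}) (hP (scheme_mem hne hP l)).2

theorem scheme_prefix_cons (hne : P.Nonempty) (hP : P ⊆ splitting P) (b : Bool) (l : List Bool) :
    scheme P l <+: scheme P (b :: l) := by
  have := splits_scheme hne hP l
  cases b
  · exact this.2.2.1
  · exact this.2.2.2.1

theorem scheme_isPrefix (hne : P.Nonempty) (hP : P ⊆ splitting P) {l l' : List Bool}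
    (h : l <:+ l') : scheme P l <+: scheme P l' := by
  obtain ⟨t, rfl⟩ := h
  induction t with
  | nil => exact List.prefix_rfl
  | cons b t ih => exact ih.trans (scheme_prefix_cons hne hP b _)

theorem length_le_length_scheme (hne : P.Nonempty) (hP : P ⊆ splitting P) (l : List Bool) :
    l.length ≤ (scheme P l).length := by
  induction l with
  | nil => simp
  | cons b l ih =>
    have hpre := scheme_prefix_cons hne hP b l
    suffices scheme P l ≠ scheme P (b :: l) by
      have hlt : (scheme P l).length < (scheme P (b :: l)).length :=
        lt_of_le_of_ne hpre.length_le fun h => this (hpre.eq_of_length h)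
      simp only [List.length_cons]
      omega
    intro heq
    have hs := splits_scheme hne hP l
    cases b
    · apply hs.2.2.2.2.1
      dsimp only
      rw [← heq]
      exact hs.2.2.2.1.map _
    · apply hs.2.2.2.2.2
      dsimp only
      rw [← heq]
      exact hs.2.2.1.map _

theorem measurable_scheme {X : Type*} [MeasurableSpace X] {P : X → Set Node}
    (hP : ∀ p, Measurable fun x => p ∈ P x) (l : List Bool) (p : Node) :
    Measurable fun x => scheme (P x) l = p := by
  induction l generalizing p with
  | nil => exact measurable_pick hP p
  | cons b l ih =>
    have : (fun x => scheme (P x) (b :: l) = p) = fun x => ∃ m c, scheme (P x) l = m ∧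
        pick {c | Splits (P x) m c} = c ∧ (if b then c.2 else c.1) = p := by
      ext x
      simp [scheme]
    rw [this]
    refine .exists fun m => .exists fun c => (ih m).and (.and (measurable_pick ?_ c) ?_)
    · intro c
      exact (hP _).and ((hP _).and measurable_const)
    · exact measurable_const

/-- The tree of initial segments of the first coordinates of the scheme. -/
def schemeTree (P : Set Node) : Set (List Bool) := {σ | ∃ l, σ <+: fsts (scheme P l)}

theorem exists_branch_of_mem_schemeTree (hne : P.Nonempty) (hP : P ⊆ splitting P) {y : ℕ → Bool}
    (hy : ∀ k, initSeg y k ∈ schemeTree P) :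
    ∃ g : ℕ → Node, (∀ k, g k ∈ P) ∧ (∀ k, g k <+: g (k + 1)) ∧ (∀ k, k ≤ (g k).length) ∧
      ∀ k, fsts (g k) = initSeg y (g k).length := by
  let Q : List Bool → Prop := fun l => ∀ j, ∃ l', l <:+ l' ∧ initSeg y j <+: fsts (scheme P l')
  have h0 : Q [] := fun j => by
    obtain ⟨l', hl'⟩ := hy j
    exact ⟨l', List.nil_suffix, hl'⟩
  have hstep : ∀ l, Q l → ∃ b, Q (b :: l) := by
    intro l hl
    by_contra! hcon
    have hj : ∀ b, ∃ j, ∀ l', b :: l <:+ l' → ¬ initSeg y j <+: fsts (scheme P l') := by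
      intro b
      have := hcon b
      simp only [Q] at this
      push Not at this
      exact this
    choose j hj using hj
    obtain ⟨l', hsuf, hpre⟩ := hl (max (max (j true) (j false)) ((scheme P l).length + 1))
    obtain ⟨t, rfl⟩ := hsuf
    rcases List.eq_nil_or_concat t with rfl | ⟨t, b, rfl⟩
    · have := hpre.length_le
      simp at this
    · refine hj b _ ⟨t, by simp⟩ ((initSeg_isPrefix y ?_).trans hpre)
      cases b <;> simp
  choose! b hb using hstep
  let f : ℕ → List Bool := fun k => Nat.rec [] (fun _ l => b l :: l) k
  have hf : ∀ k, Q (f k) := by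
    intro k
    induction k with
    | zero => exact h0
    | succ k ih => exact hb _ ih
  have hlen : ∀ k, (f k).length = k := by
    intro k
    induction k with
    | zero => rfl
    | succ k ih => exact congrArg (· + 1) ih
  refine ⟨fun k => scheme P (f k), fun k => scheme_mem hne hP _,
    fun k => scheme_prefix_cons hne hP _ _, fun k => ?_, fun k => ?_⟩
  · have := length_le_length_scheme hne hP (f k)
    rwa [hlen] at this
  · obtain ⟨l', hsuf, hpre⟩ := hf k (scheme P (f k)).length
    have h2 : fsts (scheme P (f k)) <+: fsts (scheme P l') := (scheme_isPrefix hne hP hsuf).map _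
    exact (List.prefix_of_prefix_length_le h2 hpre (by simp)).eq_of_length (by simp)

theorem mem_projBranches_of_schemeTree {S : Set Node} (hS : ∀ p ∈ S, ∀ k, p.take k ∈ S)
    (hPS : P ⊆ S) (hne : P.Nonempty) (hP : P ⊆ splitting P) {y : ℕ → Bool}
    (hy : ∀ k, initSeg y k ∈ schemeTree P) : y ∈ projBranches S := by
  obtain ⟨g, hgP, hg, hlen, hgy⟩ := exists_branch_of_mem_schemeTree hne hP hy
  have hmono : ∀ {j k}, j ≤ k → g j <+: g k := by
    intro j k h
    induction h with
    | refl => exact List.prefix_rfl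
    | step _ ih => exact ih.trans (hg _)
  let w : ℕ → Bool × ℕ := fun i => (g (i + 1)).getD i default
  have hw : ∀ k i, i < k → (g k)[i]? = some (w i) := by
    intro k i h
    have hi : i < (g (i + 1)).length := hlen (i + 1)
    rw [(List.prefix_iff_getElem?.1 (hmono h)) i hi]
    simp [w, hi]
  have htake : ∀ k, initSeg w k = (g k).take k := by
    intro k
    refine List.ext_getElem? fun i => ?_
    by_cases h : i < k
    · rw [List.getElem?_take_of_lt h, hw k i h]
      simp [h]
    · rw [List.getElem?_eq_none (by simpa using h), List.getElem?_eq_none]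
      simp only [List.length_take]
      omega
  refine ⟨w, fun k => ?_, fun i => ?_⟩
  · rw [htake]
    exact hS _ (hPS (hgP k)) k
  · have h1 := congrArg (fun l => l[i]?) (hgy (i + 1))
    have hi : i < (g (i + 1)).length := hlen (i + 1)
    simp only [List.getElem?_map, hw (i + 1) i (by omega), Option.map_some] at h1
    simpa [hi] using h1

theorem schemeTree_nil_mem : [] ∈ schemeTree P := ⟨[], _, rfl⟩

theorem schemeTree_prefix_mem {σ τ : List Bool} (h : σ <+: τ) (hτ : τ ∈ schemeTree P) :
    σ ∈ schemeTree P := by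
  obtain ⟨l, hl⟩ := hτ
  exact ⟨l, h.trans hl⟩

theorem schemeTree_splits (hne : P.Nonempty) (hP : P ⊆ splitting P) {σ : List Bool}
    (hσ : σ ∈ schemeTree P) : ∃ σ₁ ∈ schemeTree P, ∃ σ₂ ∈ schemeTree P,
      σ <+: σ₁ ∧ σ <+: σ₂ ∧ Incomp σ₁ σ₂ := by
  obtain ⟨l, hl⟩ := hσ
  exact ⟨_, ⟨false :: l, List.prefix_rfl⟩, _, ⟨true :: l, List.prefix_rfl⟩,
    hl.trans ((scheme_prefix_cons hne hP _ l).map _),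
    hl.trans ((scheme_prefix_cons hne hP _ l).map _), (splits_scheme hne hP l).2.2.2.2⟩

end Scheme

section Avoid

/-- The perfect tree of sequences which are free at even places and whose value at `2 * n + 1`
is `true` iff `Y n` fails. -/
def avoidTree (Y : ℕ → Prop) : Set (List Bool) :=
  {σ | ∀ n b, σ[2 * n + 1]? = some b → (b = true ↔ ¬ Y n)}

theorem avoidTree_nil_mem {Y : ℕ → Prop} : [] ∈ avoidTree Y := by
  intro n b h
  simp at h

theorem avoidTree_prefix_mem {Y : ℕ → Prop} {σ τ : List Bool} (h : σ <+: τ)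
    (hτ : τ ∈ avoidTree Y) : σ ∈ avoidTree Y := by
  intro n b hb
  refine hτ n b ?_
  obtain ⟨hlt, -⟩ := List.getElem?_eq_some_iff.1 hb
  rw [List.prefix_iff_getElem?.1 h _ hlt, ← hb]
  simp [hlt]

theorem avoidTree_splits {Y : ℕ → Prop} {σ : List Bool} (hσ : σ ∈ avoidTree Y) :
    ∃ σ₁ ∈ avoidTree Y, ∃ σ₂ ∈ avoidTree Y, σ <+: σ₁ ∧ σ <+: σ₂ ∧ Incomp σ₁ σ₂ := by
  classical
  let z : Bool → ℕ → Bool := fun c i =>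
    if h : i < σ.length then σ[i] else if i % 2 = 1 then decide (¬ Y (i / 2)) else c
  let pad : Bool → List Bool := fun c => initSeg (z c) (σ.length + 2)
  have hlen : ∀ c, (pad c).length = σ.length + 2 := fun c => by simp [pad]
  have hmem : ∀ c, pad c ∈ avoidTree Y := by
    intro c n b hb
    obtain ⟨hlt, hb'⟩ := List.getElem?_eq_some_iff.1 hb
    have hz : z c (2 * n + 1) = b := by simpa [pad] using hb'
    by_cases h : 2 * n + 1 < σ.length
    · refine hσ n b ?_
      rw [List.getElem?_eq_getElem h, ← hz]
      simp [z, h]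
    · have h1 : (2 * n + 1) % 2 = 1 := by omega
      have h2 : (2 * n + 1) / 2 = n := by omega
      rw [← hz]
      simp [z, h, h1, h2]
  have hpre : ∀ c, σ <+: pad c := by
    intro c
    rw [List.prefix_iff_getElem?]
    intro i hi
    have : i < σ.length + 2 := by omega
    simp [pad, z, hi, this]
  have hne : pad false ≠ pad true := by
    intro h
    let i := if σ.length % 2 = 0 then σ.length else σ.length + 1
    have hi : i < σ.length + 2 ∧ ¬ i < σ.length ∧ ¬ i % 2 = 1 := by
      simp only [i]
      split_ifs <;> omega
    have h1 := congrArg (fun l => l[i]?) h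
    simp [pad, z, hi.1, hi.2.1, hi.2.2] at h1
  refine ⟨_, hmem false, _, hmem true, hpre _, hpre _, fun h => ?_, fun h => ?_⟩
  · exact hne (h.eq_of_length (by simp [hlen]))
  · exact hne (h.eq_of_length (by simp [hlen])).symm

end Avoid

end PerfectSubtree

namespace PerfectSubtree

open Set StageComparison

section Canonical

/-- `(p, q) ∈ stages S` if `p` is removed from `S`, and not after `q`. -/
abbrev stages (S : Set Node) : Set (Node × Node) := (stageOp (removeOp S)).lfp

/-- With `p` the node of code `i`, some node extending `p` not removed before `p` has first
coordinate `true` at `2 * i + 1`. -/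
def CodedValue (S : Set Node) (L : Set (Node × Node)) (i : ℕ) : Prop :=
  ∃ p : Node, Encodable.encode p = i ∧ ∃ q ∈ S, (p, q) ∈ L ∧ p <+: q ∧
    (fsts q)[2 * i + 1]? = some true

/-- A perfect tree contained in or disjoint from the projection of the branches of `S`, where
`L = stages S`. -/
def homogeneousTree (S : Set Node) (L : Set (Node × Node)) : Set (List Bool) :=
  {σ | ((∀ p, (p, p) ∈ L) ∧ σ ∈ avoidTree (CodedValue S L)) ∨
    ((¬ ∀ p, (p, p) ∈ L) ∧ σ ∈ schemeTree {p | (p, p) ∉ L})}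

theorem notMem_projBranches_of_avoidTree {S : Set Node} (hI : ∀ p, p ∈ (removeOp S).lfp)
    {y : ℕ → Bool} (hy : ∀ k, initSeg y k ∈ avoidTree (CodedValue S (stages S))) :
    y ∉ projBranches S := by
  rintro ⟨w, hwS, hwy⟩
  obtain ⟨-, ⟨k, rfl⟩, hmin, hrem⟩ := exists_minimal (removeOp S) (removeOp_univ S)
    (B := range (initSeg w)) ⟨_, mem_range_self 0, hI _⟩
  set i := Encodable.encode (initSeg w k) with hi
  have hval : ∀ j, 2 * i + 1 < j →
      (fsts (initSeg w j))[2 * i + 1]? = some (y (2 * i + 1)) := by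
    intro j hj
    simp [hj, hwy]
  have hyi := hy (2 * i + 2) i (y (2 * i + 1)) (by simp)
  set j := max k (2 * i + 2) with hj
  have hkj : initSeg w k <+: initSeg w j := initSeg_isPrefix w (le_max_left _ _)
  have hvj := hval j (by omega)
  have hmj := hmin _ (mem_range_self j)
  by_cases hc : CodedValue S (stages S) i
  · have hyf : y (2 * i + 1) = false := by
      simpa [hc] using hyi
    obtain ⟨p, hp, q, hqS, hqL, hpq, hq⟩ := hc
    obtain rfl : p = initSeg w k := Encodable.encode_injective (hp.trans hi)
    refine hrem ⟨⟨hwS k, fun h => h (hmin _ (mem_range_self k))⟩, (q, initSeg w j),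
      ⟨hqS, fun h => h hqL⟩, ⟨hwS j, fun h => h hmj⟩, hpq, hkj, ?_⟩
    rw [hyf] at hvj
    constructor
    · intro h
      have hlt := (List.getElem?_eq_some_iff.1 hq).1
      have := List.prefix_iff_getElem?.1 h _ hlt
      rw [hvj] at this
      rw [List.getElem?_eq_getElem hlt] at hq
      simp_all
    · intro h
      have hlt := (List.getElem?_eq_some_iff.1 hvj).1
      have := List.prefix_iff_getElem?.1 h _ hlt
      rw [hq] at this
      rw [List.getElem?_eq_getElem hlt] at hvj
      simp_all
  · refine hc ⟨_, rfl, _, hwS j, hmj, hkj, ?_⟩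
    rw [hvj, hyi.2 hc]

variable {S : Set Node}

theorem compl_lfp_removeOp_subset : {p | (p, p) ∉ stages S} ⊆ S ∧
    {p | (p, p) ∉ stages S} ⊆ splitting {p | (p, p) ∉ stages S} := by
  have heq : {p | (p, p) ∉ stages S} = (removeOp S).lfpᶜ := by
    ext p
    exact not_congr (diag_mem_stageOp_lfp_iff _ (removeOp_univ S))
  rw [heq]
  refine ⟨fun p hp => ?_, fun p hp => ?_⟩
  · rw [lfp_removeOp_compl] at hp
    exact hp.1.1
  · rw [lfp_removeOp_compl] at hp
    exact splitting_mono (fun q hq => hq.2) hp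

theorem homogeneousTree_cases (S : Set Node) :
    (∃ Y, homogeneousTree S (stages S) = avoidTree Y) ∨
    ∃ P : Set Node, P.Nonempty ∧ P ⊆ splitting P ∧
      homogeneousTree S (stages S) = schemeTree P := by
  by_cases h : ∀ p, (p, p) ∈ stages S
  · left
    refine ⟨CodedValue S (stages S), ?_⟩
    ext σ
    simp [homogeneousTree, h]
  · right
    refine ⟨{p | (p, p) ∉ stages S}, by simpa [Set.Nonempty] using h,
      compl_lfp_removeOp_subset.2, ?_⟩
    ext σ
    simp only [homogeneousTree, h, mem_ofPred_eq, false_and, not_false_eq_true, true_and, false_or]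

theorem nil_mem_homogeneousTree (S : Set Node) : [] ∈ homogeneousTree S (stages S) := by
  obtain ⟨Y, h⟩ | ⟨P, -, -, h⟩ := homogeneousTree_cases S <;> rw [h]
  · exact avoidTree_nil_mem
  · exact schemeTree_nil_mem

theorem homogeneousTree_prefix_mem {σ τ : List Bool} (hστ : σ <+: τ)
    (hτ : τ ∈ homogeneousTree S (stages S)) : σ ∈ homogeneousTree S (stages S) := by
  obtain ⟨Y, h⟩ | ⟨P, -, -, h⟩ := homogeneousTree_cases S <;> rw [h] at hτ ⊢
  · exact avoidTree_prefix_mem hστ hτ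
  · exact schemeTree_prefix_mem hστ hτ

theorem homogeneousTree_splits {σ : List Bool} (hσ : σ ∈ homogeneousTree S (stages S)) :
    ∃ σ₁ ∈ homogeneousTree S (stages S), ∃ σ₂ ∈ homogeneousTree S (stages S),
      σ <+: σ₁ ∧ σ <+: σ₂ ∧ Incomp σ₁ σ₂ := by
  obtain ⟨Y, h⟩ | ⟨P, hne, hP, h⟩ := homogeneousTree_cases S <;> rw [h] at hσ ⊢
  · exact avoidTree_splits hσ
  · exact schemeTree_splits hne hP hσ

theorem homogeneousTree_homogeneous (hS : ∀ p ∈ S, ∀ k, p.take k ∈ S) :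
    (∀ y, (∀ k, initSeg y k ∈ homogeneousTree S (stages S)) → y ∈ projBranches S) ∨
    ∀ y, (∀ k, initSeg y k ∈ homogeneousTree S (stages S)) → y ∉ projBranches S := by
  by_cases h : ∀ p, (p, p) ∈ stages S
  · right
    intro y hy
    refine notMem_projBranches_of_avoidTree
      (fun p => (diag_mem_stageOp_lfp_iff _ (removeOp_univ S)).1 (h p)) fun k => ?_
    exact (hy k).elim (fun hk => hk.2) fun hk => absurd h hk.1
  · left
    intro y hy
    refine mem_projBranches_of_schemeTree hS compl_lfp_removeOp_subset.1
      (by simpa [Set.Nonempty] using h) compl_lfp_removeOp_subset.2 fun k => ?_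
    exact (hy k).elim (fun hk => absurd hk.1 h) fun hk => hk.2

end Canonical

section Measurability

variable {X : Type*} [MeasurableSpace X]

theorem measurable_mem_removeOp {S Q : X → Set Node} (hS : ∀ p, Measurable fun x => p ∈ S x)
    (hQ : ∀ p, Measurable fun x => p ∈ Q x) (p : Node) :
    Measurable fun x => p ∈ removeOp (S x) (Q x) := by
  have hd : ∀ p, Measurable fun x => p ∈ S x \ Q x := fun p => (hS p).and (hQ p).not
  exact Measurable.not ((hd p).and (.exists fun c => (hd _).and ((hd _).and measurable_const)))

theorem measurable_mem_stageOp_removeOp {S : X → Set Node} {L : X → Set (Node × Node)}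
    (hS : ∀ p, Measurable fun x => p ∈ S x) (hL : ∀ c, Measurable fun x => c ∈ L x)
    (c : Node × Node) : Measurable fun x => c ∈ stageOp (removeOp (S x)) (L x) := by
  refine measurable_mem_removeOp hS (fun n => ?_) c.1
  exact (measurable_mem_removeOp hS (fun k => (hL (n, k)).not) c.2).not

theorem measurable_mem_homogeneousTree {S : X → Set Node} {L : X → Set (Node × Node)}
    (hS : ∀ p, Measurable fun x => p ∈ S x) (hL : ∀ c, Measurable fun x => c ∈ L x)
    (σ : List Bool) : Measurable fun x => σ ∈ homogeneousTree (S x) (L x) := by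
  have hall : Measurable fun x => ∀ p, (p, p) ∈ L x := .forall fun p => hL _
  refine (hall.and (.forall fun n => .forall fun b => ?_)).or
    (hall.not.and (.exists fun l => ?_))
  · refine .imp measurable_const (.iff measurable_const (.not ?_))
    exact .exists fun p => .and measurable_const (.exists fun q =>
      (hS q).and ((hL _).and measurable_const))
  · have : (fun x => σ <+: fsts (scheme {p | (p, p) ∉ L x} l)) = fun x =>
        ∃ p, scheme {p | (p, p) ∉ L x} l = p ∧ σ <+: fsts p := by
      ext x
      simp
    rw [this]
    exact .exists fun p => .and (measurable_scheme (fun p => (hL _).not) l p) measurable_const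

end Measurability

section Universal

/-- The tree of those `p` such that `x` codes the pairs formed by the initial segments of `x`
and `p` of equal length. -/
def treeOf (x : ℕ → Bool) : Set Node :=
  {p | ∀ k ≤ p.length, x (Encodable.encode (initSeg x k, p.take k)) = true}

theorem take_mem_treeOf {x : ℕ → Bool} {p : Node} (hp : p ∈ treeOf x) (k : ℕ) :
    p.take k ∈ treeOf x := by
  intro j hj
  rw [List.length_take] at hj
  have := hp j (by omega)
  rwa [List.take_take, min_eq_left (by omega)]

theorem measurable_mem_treeOf (p : Node) : Measurable fun x : ℕ → Bool => p ∈ treeOf x := by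
  have hx : ∀ i b, Measurable fun x : ℕ → Bool => x i = b := fun i b =>
    measurableSet_setOfPred.1 (measurableSet_eq_fun (measurable_pi_apply i) measurable_const)
  refine .forall fun k => .imp measurable_const ?_
  have : (fun x : ℕ → Bool => x (Encodable.encode (initSeg x k, p.take k)) = true) = fun x =>
      ∃ l : List Bool, (l.length = k ∧ ∀ i b, l[i]? = some b → x i = b) ∧
        x (Encodable.encode (l, p.take k)) = true := by
    ext x
    constructor
    · refine fun h => ⟨_, ⟨by simp, fun i b hb => ?_⟩, h⟩
      obtain ⟨hi, hb⟩ := List.getElem?_eq_some_iff.1 hb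
      simpa using hb
    · rintro ⟨l, ⟨hl, hlx⟩, h⟩
      suffices initSeg x k = l by rwa [this]
      subst hl
      refine List.ext_getElem (by simp) fun i hi hi' => ?_
      simpa using hlx i l[i] (by simp [hi'])
  rw [this]
  exact .exists fun l => .and (.and measurable_const (.forall fun i => .forall fun b =>
    .imp measurable_const (hx i b))) (hx _ _)

theorem exists_projBranches_treeOf_eq {A : Set ((ℕ → Bool) × (ℕ → Bool))} (hA : AnalyticSet A) :
    ∃ x, ∀ y, (x, y) ∈ A ↔ y ∈ projBranches (treeOf x) := by
  classical
  rw [AnalyticSet] at hA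
  obtain rfl | ⟨f, hf, rfl⟩ := hA
  · refine ⟨fun _ => false, fun y => ?_⟩
    simp only [mem_empty_iff_false, false_iff]
    rintro ⟨w, hw, -⟩
    simpa using hw 0 0 le_rfl
  · let pair : (ℕ → ℕ) → ℕ → Bool × ℕ := fun u i => ((f u).2 i, u i)
    let x : ℕ → Bool := fun n => decide (∃ u k,
      Encodable.encode (initSeg (f u).1 k, initSeg (pair u) k) = n)
    have hx : ∀ c : List Bool × Node, x (Encodable.encode c) = true ↔
        ∃ u k, (initSeg (f u).1 k, initSeg (pair u) k) = c := by
      intro c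
      simp only [x, decide_eq_true_eq, Encodable.encode_inj]
    refine ⟨x, fun y => ⟨?_, ?_⟩⟩
    · rintro ⟨u, hu⟩
      refine ⟨pair u, fun k j hj => ?_, fun i => ?_⟩
      · rw [take_initSeg _ (by simpa using hj), hx]
        exact ⟨u, j, by rw [hu]⟩
      · simp [pair, hu]
    · rintro ⟨w, hw, hwy⟩
      have hk : ∀ k, ∃ u, initSeg (f u).1 k = initSeg x k ∧ initSeg (pair u) k = initSeg w k := by
        intro k
        have := hw k k (by simp)
        rw [take_initSeg _ le_rfl, hx] at this
        obtain ⟨u, j, huj⟩ := this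
        obtain ⟨h1, h2⟩ := Prod.mk.inj huj
        obtain rfl : j = k := by simpa using congrArg List.length h1
        exact ⟨u, h1, h2⟩
      choose u hu1 hu2 using hk
      have hlim : ∀ {α : Type} [TopologicalSpace α] {v : ℕ → ℕ → α} {z : ℕ → α},
          (∀ k i, i < k → v k i = z i) → Filter.Tendsto v Filter.atTop (nhds z) := by
        intro α _ v z h
        refine tendsto_pi_nhds.2 fun i => tendsto_const_nhds.congr' ?_
        filter_upwards [Filter.eventually_gt_atTop i] with k hk
        exact (h k i hk).symm
      have hget : ∀ {α : Type} {v z : ℕ → α} {k : ℕ}, initSeg v k = initSeg z k →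
          ∀ i < k, v i = z i := by
        intro α v z k h i hi
        exact List.map_inj_left.1 h i (List.mem_range.2 hi)
      have h1 : Filter.Tendsto u Filter.atTop (nhds fun i => (w i).2) :=
        hlim fun k i hi => congrArg Prod.snd (hget (hu2 k) i hi)
      have h2 : Filter.Tendsto (fun k => f (u k)) Filter.atTop (nhds (x, y)) := by
        refine Filter.Tendsto.prodMk_nhds (hlim fun k i hi => hget (hu1 k) i hi)
          (hlim fun k i hi => ?_)
        rw [← hwy]
        exact congrArg Prod.fst (hget (hu2 k) i hi)
      exact ⟨_, tendsto_nhds_unique ((hf.tendsto _).comp h1) h2⟩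

end Universal

open Classical in
/-- The characteristic function of the canonical perfect tree which is homogeneous for the
projection of the branches of `treeOf x`. -/
noncomputable def canonicalTree (x : ℕ → Bool) : List Bool → Bool :=
  fun σ => decide (σ ∈ homogeneousTree (treeOf x) (stages (treeOf x)))

theorem perfectBinTree_canonicalTree (x : ℕ → Bool) : PerfectBinTree (canonicalTree x) := by
  simp only [PerfectBinTree, canonicalTree, decide_eq_true_eq]
  refine ⟨nil_mem_homogeneousTree _, fun l b h =>
    homogeneousTree_prefix_mem (List.prefix_append _ _) h, fun l hl => ?_⟩
  obtain ⟨l₁, h₁, l₂, h₂, h₃, h₄, h₅⟩ := homogeneousTree_splits hl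
  exact ⟨l₁, l₂, h₁, h₂, h₃, h₄, h₅⟩

theorem sigma12_preimage_canonicalTree {V : Set (List Bool → Bool)} (hV : IsOpen V) :
    Sigma12 (canonicalTree ⁻¹' V) := by
  classical
  let Y := (ℕ → Bool) × (Node × Node → Bool)
  let τ : Y → List Bool → Bool := fun p σ =>
    decide (σ ∈ homogeneousTree (treeOf p.1) {c | p.2 c = true})
  have hS : ∀ p, Measurable fun q : Y => p ∈ treeOf q.1 := fun p =>
    (measurable_mem_treeOf p).comp measurable_fst
  have hL : ∀ c, Measurable fun q : Y => c ∈ {c | q.2 c = true} := fun c =>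
    measurableSet_setOfPred.1
      (measurableSet_eq_fun ((measurable_pi_apply c).comp measurable_snd) measurable_const)
  have hτ : Measurable τ := by
    refine measurable_pi_iff.2 fun σ => measurable_to_bool ?_
    have := measurableSet_setOfPred.2 (measurable_mem_homogeneousTree hS hL σ)
    convert this using 1
    ext q
    simp [τ]
  let G : Set Y := {p | {c | p.2 c = true} = (stageOp (removeOp (treeOf p.1))).lfp}
  have hG : AnalyticSet Gᶜ := analyticSet_lfp_graph_compl
    (fun x => stageOp (removeOp (treeOf x)))
    (measurable_set_iff.2 (measurable_mem_stageOp_removeOp hS hL))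
  have hC : AnalyticSet (G ∩ τ ⁻¹' V)ᶜ := by
    rw [compl_inter, union_eq_iUnion]
    refine AnalyticSet.iUnion fun b => ?_
    cases b
    · exact (hτ hV.measurableSet).compl.analyticSet
    · exact hG
  convert sigma12_image hC continuous_fst using 1
  ext x
  constructor
  · intro hx
    refine ⟨(x, fun c => decide (c ∈ stages (treeOf x))), ⟨?_, ?_⟩, rfl⟩
    · simp [G]
    · change τ _ ∈ V
      have : τ (x, fun c => decide (c ∈ stages (treeOf x))) = canonicalTree x := by
        ext σ
        simp [τ, canonicalTree]
      rwa [this]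
  · rintro ⟨⟨x', Z⟩, ⟨hZ, hV⟩, rfl⟩
    change {c | Z c = true} = stages (treeOf x') at hZ
    change τ (x', Z) ∈ V at hV
    simp only [τ, hZ] at hV
    exact hV

end PerfectSubtree

/-- There are a `Σ¹₂` set `R ⊆ 2^ℕ` and a `Σ¹₂`-measurable `T : R → P(2^{<ℕ})` such
that for every partition of `2^ℕ × 2^ℕ` into an analytic set `A` and a coanalytic
set `C` there is `x ∈ R` with `lim T(x) ⊆ A_x` or `lim T(x) ⊆ C_x`. -/
theorem statement11 :
    ∃ (R : Set (ℕ → Bool)) (T : (ℕ → Bool) → (List Bool → Bool)),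
      Sigma12 R ∧
      (∀ x ∈ R, PerfectBinTree (T x)) ∧
      (∀ V : Set (List Bool → Bool), IsOpen V → ∃ S, Sigma12 S ∧ T ⁻¹' V ∩ R = S ∩ R) ∧
      ∀ A C : Set ((ℕ → Bool) × (ℕ → Bool)),
        AnalyticSet A → AnalyticSet Cᶜ → A ∪ C = Set.univ → A ∩ C = ∅ →
        ∃ x ∈ R,
          limTree (T x) ⊆ {y | (x, y) ∈ A} ∨ limTree (T x) ⊆ {y | (x, y) ∈ C} := by
  refine ⟨Set.univ, PerfectSubtree.canonicalTree, ?_,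
    fun x _ => PerfectSubtree.perfectBinTree_canonicalTree x,
    fun V hV => ⟨_, PerfectSubtree.sigma12_preimage_canonicalTree hV, rfl⟩, ?_⟩
  · simpa using PerfectSubtree.sigma12_preimage_canonicalTree isOpen_univ
  · intro A C hA _ hAC _
    obtain ⟨x, hx⟩ := PerfectSubtree.exists_projBranches_treeOf_eq hA
    have hlim : ∀ y ∈ limTree (PerfectSubtree.canonicalTree x), ∀ k, PerfectSubtree.initSeg y k ∈
        PerfectSubtree.homogeneousTree (PerfectSubtree.treeOf x)
          (PerfectSubtree.stages (PerfectSubtree.treeOf x)) := by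
      intro y hy k
      simpa [PerfectSubtree.canonicalTree] using hy k
    refine ⟨x, Set.mem_univ x, ?_⟩
    refine (PerfectSubtree.homogeneousTree_homogeneous (S := PerfectSubtree.treeOf x)
      fun p hp k => PerfectSubtree.take_mem_treeOf hp k).imp ?_ ?_
    · exact fun h y hy => (hx y).2 (h y (hlim y hy))
    · intro h y hy
      have hmem : (x, y) ∈ A ∪ C := hAC ▸ Set.mem_univ (x, y)
      exact hmem.resolve_left fun hxy => h y (hlim y hy) ((hx y).1 hxy)
end

section
/- Let Y be a Polish space and let B ⊆ 2^ℕ × Y be a Borel set whose projection onto 2^ℕ is uncountable. Then there exist a perfect binary tree S and a continuous function f : lim S → Y whose graph is contained in B. -/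
open MeasureTheory TopologicalSpace

open Set Filter Topology

section CantorSubset

open CantorScheme PiNat
open scoped ENNReal

/-- If a set has uncountable image, then two of its points with distinct images have the property
that the trace of the set on each of their neighborhoods has uncountable image. -/
theorem exists_ne_image_forall_nhds_not_countable {X Z : Type*} [TopologicalSpace X]
    [SecondCountableTopology X] {h : X → Z} {E : Set X} (hE : ¬ (h '' E).Countable) :
    ∃ x y, h x ≠ h y ∧ (∀ U ∈ 𝓝 x, ¬ (h '' (U ∩ E)).Countable) ∧
      ∀ U ∈ 𝓝 y, ¬ (h '' (U ∩ E)).Countable := by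
  set G : Set X := {x | ∀ U ∈ 𝓝 x, ¬ (h '' (U ∩ E)).Countable}
  have hbad : (h '' (E \ G)).Countable := by
    have hU : ∀ x, ∃ U, x ∈ E \ G → U ∈ 𝓝 x ∧ (h '' (U ∩ E)).Countable := by
      intro x
      by_cases hx : x ∈ G
      · exact ⟨∅, fun h' => absurd hx h'.2⟩
      · simp only [G, mem_ofPred_eq, not_forall, not_not] at hx
        obtain ⟨U, hU, hc⟩ := hx
        exact ⟨U, fun _ => ⟨hU, hc⟩⟩
    choose U hU using hU
    obtain ⟨t, hts, htc, hcov⟩ := TopologicalSpace.countable_cover_nhdsWithin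
      fun x hx => mem_nhdsWithin_of_mem_nhds (t := E \ G) (hU x hx).1
    refine (htc.biUnion fun x hx => (hU x (hts hx)).2).mono ?_
    rintro _ ⟨x, hx, rfl⟩
    obtain ⟨y, hy, hxy⟩ := mem_iUnion₂.1 (hcov hx)
    exact mem_iUnion₂.2 ⟨y, hy, mem_image_of_mem h ⟨hxy, hx.1⟩⟩
  have hgood : (h '' G).Nontrivial := by
    rw [← not_subsingleton_iff]
    intro hs
    refine hE ((hbad.union hs.countable).mono ?_)
    rw [← image_union]
    exact image_mono fun x hx => by simp [hx]
  obtain ⟨_, ⟨x, hx, rfl⟩, _, ⟨y, hy, rfl⟩, hne⟩ := hgood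
  exact ⟨x, y, hne, hx, hy⟩

/-- A closed set with uncountable image under a continuous map contains two closed sets of small
diameter, with uncountable and disjoint images. -/
theorem exists_small_diam_splitting_image {X Z : Type*} [MetricSpace X]
    [SecondCountableTopology X] [TopologicalSpace Z] [T2Space Z] {h : X → Z} (hh : Continuous h)
    {E : Set X} (hEc : IsClosed E) (hE : ¬ (h '' E).Countable) {ε : ℝ≥0∞} (hε : 0 < ε) :
    ∃ C : Bool → Set X, (∀ b, (IsClosed (C b) ∧ ¬ (h '' C b).Countable) ∧ C b ⊆ E ∧
      Metric.ediam (C b) ≤ ε) ∧ Disjoint (h '' C false) (h '' C true) := by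
  obtain ⟨x, y, hne, hx, hy⟩ := exists_ne_image_forall_nhds_not_countable hE
  obtain ⟨U, V, hU, hV, hxU, hyV, hUV⟩ := t2_separation hne
  have key : ∀ z W, IsOpen W → h z ∈ W → (∀ N ∈ 𝓝 z, ¬ (h '' (N ∩ E)).Countable) →
      ∃ D, (IsClosed D ∧ ¬ (h '' D).Countable) ∧ D ⊆ E ∧ Metric.ediam D ≤ ε ∧ h '' D ⊆ W := by
    intro z W hW hz hN
    have hmem : Metric.eball z (ε / 2) ∩ h ⁻¹' W ∈ 𝓝 z :=
      inter_mem (Metric.eball_mem_nhds z (ENNReal.half_pos hε.ne'))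
        ((hW.preimage hh).mem_nhds hz)
    obtain ⟨N, hNz, hNc, hNs⟩ := exists_mem_nhds_isClosed_subset hmem
    refine ⟨N ∩ E, ⟨hNc.inter hEc, hN N hNz⟩, inter_subset_right, ?_, ?_⟩
    · calc Metric.ediam (N ∩ E) ≤ Metric.ediam (Metric.eball z (ε / 2)) :=
            Metric.ediam_mono fun w hw => (hNs hw.1).1
        _ ≤ 2 * (ε / 2) := Metric.ediam_eball_le
        _ = ε := ENNReal.mul_div_cancel (by simp) (by simp)
    · rintro _ ⟨w, hw, rfl⟩
      exact (hNs hw.1).2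
  obtain ⟨D₀, h₀, hs₀, hd₀, hi₀⟩ := key x U hU hxU hx
  obtain ⟨D₁, h₁, hs₁, hd₁, hi₁⟩ := key y V hV hyV hy
  refine ⟨fun b => cond b D₁ D₀, ?_, hUV.mono hi₀ hi₁⟩
  rintro (_ | _)
  exacts [⟨h₀, hs₀, hd₀⟩, ⟨h₁, hs₁, hd₁⟩]

/-- A continuous map with uncountable range on a Polish space is injective on a continuous image
of the Cantor space, parametrized injectively. -/
theorem exists_nat_bool_injective_comp_of_not_countable_range {X Z : Type*} [TopologicalSpace X]
    [PolishSpace X] [TopologicalSpace Z] [T2Space Z] {h : X → Z} (hh : Continuous h)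
    (hr : ¬ (range h).Countable) :
    ∃ φ : (ℕ → Bool) → X, Continuous φ ∧ Function.Injective (h ∘ φ) := by
  let := TopologicalSpace.upgradeIsCompletelyMetrizable X
  obtain ⟨u, -, upos', hu⟩ := exists_seq_strictAnti_tendsto' (zero_lt_one' ℝ≥0∞)
  have upos := fun n => (upos' n).1
  let P := Subtype fun E : Set X => IsClosed E ∧ ¬ (h '' E).Countable
  choose C hC hdisj using fun (E : P) (n : ℕ) =>
    exists_small_diam_splitting_image hh E.2.1 E.2.2 (upos n)
  let DP : List Bool → P := fun l =>
    l.rec ⟨univ, isClosed_univ, by rwa [image_univ]⟩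
      fun a l ih => ⟨C ih (l.length + 1) a, (hC ih (l.length + 1) a).1⟩
  let D : List Bool → Set X := fun l => (DP l).val
  have hanti : ClosureAntitone D :=
    Antitone.closureAntitone (fun l a => (hC (DP l) (l.length + 1) a).2.1) fun l => (DP l).2.1
  have hdiam : VanishingDiam D := by
    intro x
    refine tendsto_of_tendsto_of_tendsto_of_le_of_le' tendsto_const_nhds hu (by simp) ?_
    filter_upwards [eventually_ge_atTop 1] with m hm
    obtain ⟨n, rfl⟩ := Nat.exists_eq_add_of_le' hm
    calc Metric.ediam (D (res x (n + 1))) ≤ u ((res x n).length + 1) :=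
          (hC (DP (res x n)) ((res x n).length + 1) (x n)).2.2
      _ = u (n + 1) := by rw [res_length]
  have hdisj' : CantorScheme.Disjoint fun l => h '' D l := by
    rintro l (a | a) (b | b) hab <;> try contradiction
    · exact hdisj (DP l) (l.length + 1)
    · exact (hdisj (DP l) (l.length + 1)).symm
  have hdom : ∀ x : ℕ → Bool, x ∈ (inducedMap D).1 := fun x => by
    rw [hanti.map_of_vanishingDiam hdiam fun l => ?_]
    · exact mem_univ x
    · by_contra hempty
      exact (DP l).2.2 (by simp [D, not_nonempty_iff_eq_empty.1 hempty])
  refine ⟨fun x => (inducedMap D).2 ⟨x, hdom x⟩, hdiam.map_continuous.comp (by fun_prop), ?_⟩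
  have hmem : ∀ x n, h ((inducedMap D).2 ⟨x, hdom x⟩) ∈ h '' D (res x n) :=
    fun x n => mem_image_of_mem h (map_mem ⟨x, hdom x⟩ n)
  intro x y hxy
  apply res_injective
  ext n : 1
  induction n with
  | zero => simp
  | succ n ih =>
    simp only [res_succ, List.cons.injEq]
    refine ⟨?_, ih⟩
    by_contra hne
    refine disjoint_left.1 (hdisj' (res x n) hne) (hmem x (n + 1)) ?_
    rw [ih, ← res_succ]
    exact (congrArg (· ∈ h '' D (res y (n + 1))) hxy).mpr (hmem y (n + 1))

end CantorSubset

section BranchTree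

/-- The tree of finite initial segments of members of a set of infinite binary sequences. -/
noncomputable def initialSegmentTree (K : Set (ℕ → Bool)) (l : List Bool) : Bool :=
  open Classical in decide (∃ x ∈ K, (List.range l.length).map x = l)

theorem initialSegmentTree_eq_true {K : Set (ℕ → Bool)} {l : List Bool} :
    initialSegmentTree K l = true ↔ ∃ x ∈ K, (List.range l.length).map x = l := by
  simp [initialSegmentTree]

theorem initialSegmentTree_map_range {K : Set (ℕ → Bool)} {x : ℕ → Bool} (hx : x ∈ K) (n : ℕ) :
    initialSegmentTree K ((List.range n).map x) = true :=
  initialSegmentTree_eq_true.2 ⟨x, hx, by simp⟩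

theorem map_range_eq_map_range_iff {x y : ℕ → Bool} {n : ℕ} :
    (List.range n).map x = (List.range n).map y ↔ y ∈ PiNat.cylinder x n := by
  simp [PiNat.cylinder, eq_comm]

theorem map_range_prefix (x : ℕ → Bool) {m n : ℕ} (h : m ≤ n) :
    (List.range m).map x <+: (List.range n).map x := by
  obtain ⟨k, rfl⟩ := Nat.exists_eq_add_of_le h
  rw [List.range_add, List.map_append]
  exact List.prefix_append _ _

theorem limTree_initialSegmentTree {K : Set (ℕ → Bool)} (hK : IsClosed K) :
    limTree (initialSegmentTree K) = K := by
  refine Subset.antisymm (fun x hx => ?_) fun x hx n => initialSegmentTree_map_range hx n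
  rw [← hK.closure_eq, (PiNat.isTopologicalBasis_cylinders _).mem_closure_iff]
  rintro _ ⟨y, n, rfl⟩ hxy
  obtain ⟨z, hz, hzx⟩ := initialSegmentTree_eq_true.1 (hx n)
  rw [List.length_map, List.length_range, eq_comm, map_range_eq_map_range_iff] at hzx
  rw [← PiNat.mem_cylinder_iff_eq.1 hxy]
  exact ⟨z, hzx, hz⟩

theorem perfectBinTree_initialSegmentTree {K : Set (ℕ → Bool)} (hK : Preperfect K)
    (hne : K.Nonempty) : PerfectBinTree (initialSegmentTree K) := by
  obtain ⟨x₀, hx₀⟩ := hne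
  refine ⟨initialSegmentTree_map_range hx₀ 0, fun l b hl => ?_, fun l hl => ?_⟩
  · obtain ⟨x, hx, hxl⟩ := initialSegmentTree_eq_true.1 hl
    rw [List.length_append, List.length_singleton, List.range_succ, List.map_append] at hxl
    exact initialSegmentTree_eq_true.2 ⟨x, hx, (List.append_inj hxl (by simp)).1⟩
  · obtain ⟨x, hx, hxl⟩ := initialSegmentTree_eq_true.1 hl
    set n := l.length
    obtain ⟨y, ⟨hyn, hy⟩, hyx⟩ := preperfect_iff_nhds.1 hK x hx (PiNat.cylinder x n)
      ((PiNat.isOpen_cylinder _ x n).mem_nhds (PiNat.self_mem_cylinder x n))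
    have hyl : (List.range n).map y = l := by
      rw [← map_range_eq_map_range_iff.2 hyn, hxl]
    obtain ⟨m, hm⟩ := Function.ne_iff.1 hyx
    have hnm : n ≤ m := le_of_not_gt fun hlt => hm (hyn m hlt)
    have hdiff : (List.range (m + 1)).map x ≠ (List.range (m + 1)).map y := fun h =>
      hm (map_range_eq_map_range_iff.1 h m m.lt_succ_self)
    refine ⟨_, _, initialSegmentTree_map_range hx (m + 1), initialSegmentTree_map_range hy (m + 1),
      ?_, ?_, fun h => hdiff (h.eq_of_length (by simp)),
      fun h => hdiff (h.eq_of_length (by simp)).symm⟩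
    · exact hxl ▸ map_range_prefix x (hnm.trans m.le_succ)
    · exact hyl ▸ map_range_prefix y (hnm.trans m.le_succ)

end BranchTree

/-- The Cantor space has no isolated points. -/
theorem preperfect_univ_nat_bool : Preperfect (univ : Set (ℕ → Bool)) := by
  rw [preperfect_iff_nhds]
  intro x _ U hU
  have hlim : Tendsto (fun n => Function.update x n (!x n)) atTop (𝓝 x) := by
    refine tendsto_pi_nhds.2 fun i => tendsto_const_nhds.congr' ?_
    filter_upwards [eventually_gt_atTop i] with n hn
    rw [Function.update_of_ne hn.ne]
  obtain ⟨n, hn⟩ := (hlim.eventually hU).exists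
  exact ⟨_, ⟨hn, mem_univ _⟩, fun h => by simpa using congrFun h n⟩

/-- The range of a continuous injection of the Cantor space has no isolated points. -/
theorem preperfect_range_nat_bool {Z : Type*} [TopologicalSpace Z] {k : (ℕ → Bool) → Z}
    (hk : Continuous k) (hinj : Function.Injective k) : Preperfect (range k) := by
  rw [preperfect_iff_nhds]
  rintro _ ⟨x, rfl⟩ U hU
  obtain ⟨y, ⟨hy, -⟩, hyx⟩ := preperfect_iff_nhds.1 preperfect_univ_nat_bool x (mem_univ x) _
    (hk.continuousAt.preimage_mem_nhds hU)
  exact ⟨k y, ⟨hy, mem_range_self y⟩, hinj.ne hyx⟩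

/-- Sacks uniformization: if `B ⊆ 2^ℕ × Y` is Borel with uncountable projection to
`2^ℕ`, then there are a perfect binary tree `S` and a continuous `f : lim S → Y`
whose graph is contained in `B`. -/
theorem statement12 (Y : Type) [TopologicalSpace Y] [PolishSpace Y]
    (B : Set ((ℕ → Bool) × Y)) (hB : MeasurableSet[borel ((ℕ → Bool) × Y)] B)
    (hproj : ¬ (Prod.fst '' B).Countable) :
    ∃ S : List Bool → Bool, PerfectBinTree S ∧
      ∃ f : (ℕ → Bool) → Y, ContinuousOn f (limTree S) ∧
        ∀ x ∈ limTree S, (x, f x) ∈ B := by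
  have hBa : AnalyticSet B := by
    let : MeasurableSpace ((ℕ → Bool) × Y) := borel _
    have : IsCompletelyMetrizableSpace (ℕ → Bool) := IsCompletelyMetrizableSpace.pi_countable
    have : BorelSpace ((ℕ → Bool) × Y) := ⟨rfl⟩
    exact hB.analyticSet
  rw [AnalyticSet] at hBa
  obtain rfl | ⟨g, hg, rfl⟩ := hBa
  · simp at hproj
  rw [← range_comp] at hproj
  obtain ⟨φ, hφ, hinj⟩ :=
    exists_nat_bool_injective_comp_of_not_countable_range (continuous_fst.comp hg) hproj
  set k : (ℕ → Bool) → ℕ → Bool := (Prod.fst ∘ g) ∘ φ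
  have hk : Continuous k := (continuous_fst.comp hg).comp hφ
  have hemb := hk.isClosedEmbedding hinj
  refine ⟨initialSegmentTree (range k),
    perfectBinTree_initialSegmentTree (preperfect_range_nat_bool hk hinj) (range_nonempty k),
    fun x => (g (φ (Function.invFun k x))).2, ?_, ?_⟩
  all_goals rw [limTree_initialSegmentTree hemb.isClosed_range]
  · have hinv : ContinuousOn (Function.invFun k) (range k) := by
      rw [continuousOn_iff_continuous_domRestrict,
        ← hemb.isEmbedding.toHomeomorph.comp_continuous_iff']
      refine continuous_id.congr fun x => ?_
      exact (Function.leftInverse_invFun hinj x).symm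
    exact (continuous_snd.comp (hg.comp hφ)).comp_continuousOn hinv
  · rintro _ ⟨x, rfl⟩
    exact ⟨φ x, by simp only [Function.leftInverse_invFun hinj x]; rfl⟩
end
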